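/- arXiv:1110.3438 — 8 statements merged into one kernel-verified Lean document; each statement's English description precedes it below -/
import Mathlib

section
/- For every r ∈ [0,R], the function r ↦ ∫₀^{s(r)} |v(r,z)|² dz is differentiable and its derivative equals ṡ(r)·|v(r,s(r))|² + (2/λ)·Im(q)·∫₀^{s(r)} |v_r(r,z)|² dz − (2/λ)·∫₀^{s(r)} Im(β(r,z))·|F(v;r,z)|² dz − (2α²/λ)·Im[ F(v_z;r,s(r)) · conj(F(v;r,s(r))) ], where F(v_z;r,z) := q·v_{rz}(r,z) − iλ·v_z(r,z). -/
open Complex Set MeasureTheory intervalIntegral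

/-- Partial derivative in the first (range) variable. -/
noncomputable def pr (f : ℝ → ℝ → ℂ) (r z : ℝ) : ℂ := deriv (fun t => f t z) r

/-- Partial derivative in the second (depth) variable. -/
noncomputable def pz (f : ℝ → ℝ → ℂ) (r z : ℝ) : ℂ := deriv (fun w => f r w) z

/-- The waveguide domain `𝒟 = {(r,z) : 0 ≤ r ≤ R, 0 ≤ z ≤ s(r)}`. -/
def wgDom (R : ℝ) (s : ℝ → ℝ) : Set (ℝ × ℝ) :=
  {p : ℝ × ℝ | p.1 ∈ Icc 0 R ∧ p.2 ∈ Icc 0 (s p.1)}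

/-- Smoothness on an open neighborhood of the domain `𝒟`. -/
def SmoothNearDom (R : ℝ) (s : ℝ → ℝ) (f : ℝ → ℝ → ℂ) : Prop :=
  ∃ U : Set (ℝ × ℝ), IsOpen U ∧ wgDom R s ⊆ U ∧
    ContDiffOn ℝ (⊤ : ℕ∞) (fun p : ℝ × ℝ => f p.1 p.2) U

section PartialDerivatives

variable {U : Set (ℝ × ℝ)} {f : ℝ → ℝ → ℂ} {r z : ℝ}

theorem hasDerivAt_pr (hU : IsOpen U)
    (hf : ContDiffOn ℝ (⊤ : ℕ∞) (fun p : ℝ × ℝ => f p.1 p.2) U) (h : (r, z) ∈ U) :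
    HasDerivAt (fun t => f t z) (pr f r z) r := by
  have hd : DifferentiableAt ℝ (fun p : ℝ × ℝ => f p.1 p.2) (r, z) :=
    (hf.differentiableOn (by simp)).differentiableAt (hU.mem_nhds h)
  have hline : DifferentiableAt ℝ (fun t : ℝ => (t, z)) r := by fun_prop
  exact (hd.comp r hline).hasDerivAt

theorem hasDerivAt_pz (hU : IsOpen U)
    (hf : ContDiffOn ℝ (⊤ : ℕ∞) (fun p : ℝ × ℝ => f p.1 p.2) U) (h : (r, z) ∈ U) :
    HasDerivAt (fun w => f r w) (pz f r z) z := by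
  have hd : DifferentiableAt ℝ (fun p : ℝ × ℝ => f p.1 p.2) (r, z) :=
    (hf.differentiableOn (by simp)).differentiableAt (hU.mem_nhds h)
  have hline : DifferentiableAt ℝ (fun w : ℝ => (r, w)) z := by fun_prop
  exact (hd.comp z hline).hasDerivAt

theorem pr_eq_fderiv (hU : IsOpen U)
    (hf : ContDiffOn ℝ (⊤ : ℕ∞) (fun p : ℝ × ℝ => f p.1 p.2) U) (h : (r, z) ∈ U) :
    pr f r z = fderiv ℝ (fun p : ℝ × ℝ => f p.1 p.2) (r, z) (1, 0) := by
  have hd : DifferentiableAt ℝ (fun p : ℝ × ℝ => f p.1 p.2) (r, z) :=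
    (hf.differentiableOn (by simp)).differentiableAt (hU.mem_nhds h)
  have hline : HasDerivAt (fun t : ℝ => (t, z)) ((1 : ℝ), (0 : ℝ)) r :=
    (hasDerivAt_id r).prodMk (hasDerivAt_const r z)
  exact (hd.hasFDerivAt.comp_hasDerivAt r hline).deriv

theorem pz_eq_fderiv (hU : IsOpen U)
    (hf : ContDiffOn ℝ (⊤ : ℕ∞) (fun p : ℝ × ℝ => f p.1 p.2) U) (h : (r, z) ∈ U) :
    pz f r z = fderiv ℝ (fun p : ℝ × ℝ => f p.1 p.2) (r, z) (0, 1) := by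
  have hd : DifferentiableAt ℝ (fun p : ℝ × ℝ => f p.1 p.2) (r, z) :=
    (hf.differentiableOn (by simp)).differentiableAt (hU.mem_nhds h)
  have hline : HasDerivAt (fun w : ℝ => (r, w)) ((0 : ℝ), (1 : ℝ)) z :=
    (hasDerivAt_const z r).prodMk (hasDerivAt_id z)
  exact (hd.hasFDerivAt.comp_hasDerivAt z hline).deriv

theorem contDiffOn_fderiv (hU : IsOpen U)
    (hf : ContDiffOn ℝ (⊤ : ℕ∞) (fun p : ℝ × ℝ => f p.1 p.2) U) :
    ContDiffOn ℝ (⊤ : ℕ∞) (fderiv ℝ (fun p : ℝ × ℝ => f p.1 p.2)) U :=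
  hf.fderiv_of_isOpen hU (by simp)

theorem contDiffOn_pr (hU : IsOpen U)
    (hf : ContDiffOn ℝ (⊤ : ℕ∞) (fun p : ℝ × ℝ => f p.1 p.2) U) :
    ContDiffOn ℝ (⊤ : ℕ∞) (fun p : ℝ × ℝ => pr f p.1 p.2) U :=
  ((contDiffOn_fderiv hU hf).clm_apply contDiffOn_const).congr
    fun _ hp => pr_eq_fderiv hU hf hp

theorem contDiffOn_pz (hU : IsOpen U)
    (hf : ContDiffOn ℝ (⊤ : ℕ∞) (fun p : ℝ × ℝ => f p.1 p.2) U) :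
    ContDiffOn ℝ (⊤ : ℕ∞) (fun p : ℝ × ℝ => pz f p.1 p.2) U :=
  ((contDiffOn_fderiv hU hf).clm_apply contDiffOn_const).congr
    fun _ hp => pz_eq_fderiv hU hf hp

/-- Mixed partial derivatives of a smooth function commute. -/
theorem pz_pr_comm (hU : IsOpen U)
    (hf : ContDiffOn ℝ (⊤ : ℕ∞) (fun p : ℝ × ℝ => f p.1 p.2) U) (h : (r, z) ∈ U) :
    pz (pr f) r z = pr (pz f) r z := by
  have hsymm : IsSymmSndFDerivAt ℝ (fun p : ℝ × ℝ => f p.1 p.2) (r, z) :=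
    (hf.contDiffAt (hU.mem_nhds h)).isSymmSndFDerivAt (by
      rw [minSmoothness_of_isRCLikeNormedField]
      exact WithTop.coe_le_coe.2 (le_top (a := (2 : ℕ∞))))
  have hdd : DifferentiableAt ℝ (fderiv ℝ (fun p : ℝ × ℝ => f p.1 p.2)) (r, z) :=
    ((contDiffOn_fderiv hU hf).differentiableOn (by simp)).differentiableAt (hU.mem_nhds h)
  have hr : (fun p : ℝ × ℝ => pr f p.1 p.2) =ᶠ[nhds (r, z)]
      fun p => fderiv ℝ (fun p : ℝ × ℝ => f p.1 p.2) p (1, 0) :=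
    Filter.eventually_of_mem (hU.mem_nhds h) fun _ hp => pr_eq_fderiv hU hf hp
  have hz : (fun p : ℝ × ℝ => pz f p.1 p.2) =ᶠ[nhds (r, z)]
      fun p => fderiv ℝ (fun p : ℝ × ℝ => f p.1 p.2) p (0, 1) :=
    Filter.eventually_of_mem (hU.mem_nhds h) fun _ hp => pz_eq_fderiv hU hf hp
  rw [pz_eq_fderiv hU (contDiffOn_pr hU hf) h, pr_eq_fderiv hU (contDiffOn_pz hU hf) h,
    hr.fderiv_eq, hz.fderiv_eq, fderiv_clm_apply hdd (by fun_prop),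
    fderiv_clm_apply hdd (by fun_prop)]
  simpa using hsymm (0, 1) (1, 0)

theorem ContDiffOn.continuousOn_vertical {E : Type*} [NormedAddCommGroup E] [NormedSpace ℝ E]
    {g : ℝ → ℝ → E} {S : Set ℝ} {n : WithTop ℕ∞}
    (hg : ContDiffOn ℝ n (fun p : ℝ × ℝ => g p.1 p.2) U) (h : ∀ z ∈ S, (r, z) ∈ U) :
    ContinuousOn (fun z => g r z) S :=
  hg.continuousOn.comp (f := fun z : ℝ => (r, z)) (by fun_prop) h

end PartialDerivatives

/-- **Leibniz rule** with a variable upper endpoint, for an integrand that is continuously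
differentiable near the segment of integration. -/
theorem hasDerivAt_integral_variable_upper {g : ℝ → ℝ → ℝ} {s : ℝ → ℝ} {U : Set (ℝ × ℝ)}
    {a r s' : ℝ} (hU : IsOpen U) (hg : ContDiffOn ℝ 1 (fun p : ℝ × ℝ => g p.1 p.2) U)
    (has : a ≤ s r) (hseg : ∀ z ∈ Icc a (s r), (r, z) ∈ U) (hs : HasDerivAt s s' r) :
    HasDerivAt (fun t => ∫ z in a..(s t), g t z)
      ((∫ z in a..(s r), deriv (fun t => g t z) r) + s' * g r (s r)) r := by
  obtain ⟨V, W, hV, hW, hrV, hKW, hVW⟩ := generalized_tube_lemma (isCompact_singleton (x := r))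
    (isCompact_Icc (a := a) (b := s r)) hU (by
      rintro ⟨t, z⟩ ⟨rfl : t = r, hz⟩
      exact hseg z hz)
  obtain ⟨ε, hε, hεV⟩ := Metric.nhds_basis_closedBall.mem_iff.1
    (hV.mem_nhds (hrV (mem_singleton r)))
  obtain ⟨δ, hδ, hδW⟩ := isCompact_Icc.exists_cthickening_subset_open hW hKW
  have hball : ∀ z ∈ Icc (a - δ) (s r + δ), z ∈ W := by
    intro z hz
    apply hδW
    rcases le_total z a with hza | hza
    · exact Metric.mem_cthickening_of_dist_le z a δ _ (left_mem_Icc.2 has)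
        (by rw [Real.dist_eq, abs_le]; constructor <;> linarith [hz.1])
    rcases le_total z (s r) with hzs | hzs
    · exact Metric.self_subset_cthickening _ ⟨hza, hzs⟩
    · exact Metric.mem_cthickening_of_dist_le z (s r) δ _ (right_mem_Icc.2 has)
        (by rw [Real.dist_eq, abs_le]; constructor <;> linarith [hz.2])
  set K := Metric.closedBall r ε
  set L := Icc (a - δ) (s r + δ)
  have hKL : K ×ˢ L ⊆ U := fun p hp => hVW ⟨hεV hp.1, hball p.2 hp.2⟩
  have hK : ∀ t ∈ K, ∀ z ∈ L, (t, z) ∈ U := fun t ht z hz => hKL ⟨ht, hz⟩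
  have hrK : r ∈ K := Metric.mem_closedBall_self hε.le
  have haL : a ∈ L := ⟨by linarith, by linarith⟩
  have hsL : s r ∈ L := ⟨by linarith, by linarith⟩
  have hfd : ∀ t ∈ K, ∀ z ∈ L, HasDerivAt (fun t => g t z)
      (fderiv ℝ (fun p : ℝ × ℝ => g p.1 p.2) (t, z) (1, 0)) t := by
    intro t ht z hz
    have hd : DifferentiableAt ℝ (fun p : ℝ × ℝ => g p.1 p.2) (t, z) :=
      (hg.differentiableOn (by simp)).differentiableAt (hU.mem_nhds (hK t ht z hz))
    exact hd.hasFDerivAt.comp_hasDerivAt t ((hasDerivAt_id t).prodMk (hasDerivAt_const t z))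
  have hcd : ContinuousOn (fun p : ℝ × ℝ => fderiv ℝ (fun p : ℝ × ℝ => g p.1 p.2) p (1, 0)) U :=
    (hg.continuousOn_fderiv_of_isOpen hU (by simp)).clm_apply continuousOn_const
  obtain ⟨C, hC⟩ := ((isCompact_closedBall r ε).prod isCompact_Icc).exists_bound_of_continuousOn
    (hcd.mono hKL)
  have hcont : ∀ t ∈ K, ContinuousOn (fun z => g t z) L := fun t ht =>
    hg.continuousOn_vertical (hK t ht)
  have hint : ∀ t ∈ K, ∀ x ∈ L, ∀ y ∈ L, IntervalIntegrable (fun z => g t z) volume x y :=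
    fun t ht x hx y hy =>
      ((hcont t ht).mono (ordConnected_Icc.uIcc_subset hx hy)).intervalIntegrable
  have hsub : uIoc a (s r) ⊆ L :=
    uIoc_subset_uIcc.trans (ordConnected_Icc.uIcc_subset haL hsL)
  have hKnhds : K ∈ nhds r := Metric.closedBall_mem_nhds r hε
  have hsnhds : ∀ᶠ t in nhds r, s t ∈ L :=
    hs.continuousAt.eventually (Icc_mem_nhds (by linarith) (by linarith))
  have hfixed : HasDerivAt (fun t => ∫ z in a..(s r), g t z)
      (∫ z in a..(s r), fderiv ℝ (fun p : ℝ × ℝ => g p.1 p.2) (r, z) (1, 0)) r := by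
    refine (hasDerivAt_integral_of_dominated_loc_of_deriv_le (bound := fun _ => C)
      (F' := fun t z => fderiv ℝ (fun p : ℝ × ℝ => g p.1 p.2) (t, z) (1, 0))
      hKnhds ?_ (hint r hrK a haL _ hsL) ?_ ?_ intervalIntegrable_const ?_).2
    · filter_upwards [hKnhds] with t ht
      exact ((hcont t ht).mono hsub).aestronglyMeasurable measurableSet_uIoc
    · exact ((hcd.comp (f := fun z : ℝ => (r, z)) (by fun_prop) (hK r hrK)).mono
        hsub).aestronglyMeasurable measurableSet_uIoc
    · exact Filter.Eventually.of_forall fun z hz t ht => hC (t, z) ⟨ht, hsub hz⟩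
    · exact Filter.Eventually.of_forall fun z hz t ht => hfd t ht z (hsub hz)
  have hmoving : HasDerivAt (fun t => ∫ z in (s r)..(s t), g r z) (g r (s r) * s') r := by
    refine HasDerivAt.comp r (h₂ := fun x => ∫ z in (s r)..x, g r z) ?_ hs
    have hLnhds : L ∈ nhds (s r) := Icc_mem_nhds (by linarith) (by linarith)
    exact integral_hasDerivAt_right (hint r hrK _ hsL _ hsL)
      ((hcont r hrK).stronglyMeasurableAtFilter_nhdsWithin measurableSet_Icc (s r) |>.filter_mono
        (by rw [nhdsWithin_eq_nhds.2 hLnhds])) ((hcont r hrK).continuousAt hLnhds)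
  have hrem : HasDerivAt (fun t => ∫ z in (s r)..(s t), (g t z - g r z)) 0 r := by
    have hbound : ∀ᶠ t in nhds r,
        ‖∫ z in (s r)..(s t), (g t z - g r z)‖ ≤ C * ‖(t - r) * (s t - s r)‖ := by
      filter_upwards [hKnhds, hsnhds] with t ht hst
      have hb : ∀ z ∈ uIoc (s r) (s t), ‖g t z - g r z‖ ≤ C * ‖t - r‖ := fun z hz =>
        have hzL : z ∈ L := ordConnected_Icc.uIcc_subset hsL hst (uIoc_subset_uIcc hz)
        (convex_closedBall r ε).norm_image_sub_le_of_norm_hasDerivWithin_le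
          (fun x hx => (hfd x hx z hzL).hasDerivWithinAt) (fun x hx => hC (x, z) ⟨hx, hzL⟩) hrK ht
      calc _ ≤ C * ‖t - r‖ * |s t - s r| := norm_integral_le_of_norm_le_const hb
        _ = _ := by rw [norm_mul, Real.norm_eq_abs (s t - s r), mul_assoc]
    have hlim : Filter.Tendsto (fun t => s t - s r) (nhds r) (nhds 0) := by
      simpa using hs.continuousAt.tendsto.sub_const (s r)
    rw [hasDerivAt_iff_isLittleO]
    simp only [integral_same, sub_zero, smul_zero]
    have ho : (fun t => (t - r) * (s t - s r)) =o[nhds r] fun t => t - r := by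
      simpa using (Asymptotics.isBigO_refl (fun t => t - r) (nhds r)).mul_isLittleO
        ((Asymptotics.isLittleO_one_iff ℝ).2 hlim)
    exact (Asymptotics.IsBigO.of_bound C hbound).trans_isLittleO ho
  have hsum := (hfixed.add hmoving).add hrem
  have hderiv : (∫ z in a..(s r), deriv (fun t => g t z) r)
      = ∫ z in a..(s r), fderiv ℝ (fun p : ℝ × ℝ => g p.1 p.2) (r, z) (1, 0) :=
    integral_congr fun z hz =>
      (hfd r hrK z (ordConnected_Icc.uIcc_subset haL hsL hz)).deriv
  rw [hderiv]
  refine (hsum.congr_of_eventuallyEq ?_).congr_deriv (by ring)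
  filter_upwards [hKnhds, hsnhds] with t ht hst
  simp only [Pi.add_apply]
  rw [integral_sub (hint t ht _ hsL _ hst) (hint r hrK _ hsL _ hst),
    ← integral_add_adjacent_intervals (hint t ht a haL _ hsL) (hint t ht _ hsL _ hst)]
  ring

/-- The pointwise energy identity: `w` stands for `v_r`, and `G` for `F_zz`. -/
theorem energy_density_eq {q b v w G : ℂ} {α lam : ℝ} (hlam : lam ≠ 0)
    (h : w + b * (q * w - I * lam * v) + (α : ℂ) ^ 2 * G = 0) :
    2 * (inner ℝ v w : ℝ) = 2 / lam * q.im * ‖w‖ ^ 2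
      - 2 / lam * (b.im * ‖q * w - I * lam * v‖ ^ 2)
      - 2 * α ^ 2 / lam * (G * (starRingEnd ℂ) (q * w - I * lam * v)).im := by
  have him : (w * (starRingEnd ℂ) (q * w - I * lam * v)).im
      + b.im * ‖q * w - I * lam * v‖ ^ 2
      + α ^ 2 * (G * (starRingEnd ℂ) (q * w - I * lam * v)).im = 0 := by
    have h' := congrArg (fun x => (x * (starRingEnd ℂ) (q * w - I * lam * v)).im) h
    simp only [zero_mul, zero_im] at h'
    rw [← h', add_mul, add_mul, mul_assoc b, mul_assoc ((α : ℂ) ^ 2), mul_conj, ← ofReal_pow,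
      add_im, add_im, im_mul_ofReal, im_ofReal_mul, normSq_eq_norm_sq]
  have hw : (w * (starRingEnd ℂ) (q * w - I * lam * v)).im
      = lam * (inner ℝ v w : ℝ) - q.im * ‖w‖ ^ 2 := by
    rw [← normSq_eq_norm_sq, Complex.inner]
    simp [normSq_apply]
    ring
  rw [hw] at him
  field_simp
  linarith

/-- Identity (2.2): the derivative of `r ↦ ∫₀^{s(r)} |v(r,z)|² dz` equals
`ṡ(r)|v(r,s(r))|² + (2/λ) Im q ‖v_r(r,·)‖² - (2/λ) ∫ Im β |F(v)|² dz
 - (2α²/λ) Im [F(v_z;r,s(r)) conj(F(v;r,s(r)))]`,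
where `F(w;r,z) = q w_r - iλ w`. -/
theorem stmt_0 (R α : ℝ) (q : ℂ) (lam : ℝ) (s : ℝ → ℝ) (β v : ℝ → ℝ → ℂ)
    (hR : 0 < R) (hα : 0 < α) (hq : q ≠ 0) (hlam : lam ≠ 0)
    (hs : ContDiff ℝ 1 s) (hspos : ∀ r ∈ Icc (0:ℝ) R, 0 < s r)
    (hβ : SmoothNearDom R s β) (hv : SmoothNearDom R s v)
    (hpde : ∀ r ∈ Icc (0:ℝ) R, ∀ z ∈ Icc (0:ℝ) (s r),
      (1 + q * β r z) * pr v r z + (α : ℂ) ^ 2 * q * pr (pz (pz v)) r z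
        = Complex.I * (lam : ℂ) * ((α : ℂ) ^ 2 * pz (pz v) r z + β r z * v r z))
    (hsurf : ∀ r ∈ Icc (0:ℝ) R, v r 0 = 0) :
    ∀ r ∈ Icc (0:ℝ) R,
      HasDerivWithinAt (fun t => ∫ z in (0:ℝ)..(s t), ‖v t z‖ ^ 2)
        (deriv s r * ‖v r (s r)‖ ^ 2
          + (2 / lam) * q.im * (∫ z in (0:ℝ)..(s r), ‖pr v r z‖ ^ 2)
          - (2 / lam) * (∫ z in (0:ℝ)..(s r),
              (β r z).im * ‖q * pr v r z - Complex.I * (lam : ℂ) * v r z‖ ^ 2)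
          - (2 * α ^ 2 / lam) *
              ((q * pr (pz v) r (s r) - Complex.I * (lam : ℂ) * pz v r (s r))
                * (starRingEnd ℂ)
                    (q * pr v r (s r) - Complex.I * (lam : ℂ) * v r (s r))).im)
        (Icc 0 R) r := by
  obtain ⟨U, hU, hDU, hvU⟩ := hv
  obtain ⟨U', hU', hDU', hβU⟩ := hβ
  intro r hr
  have hs0 : 0 ≤ s r := (hspos r hr).le
  have hseg : ∀ z ∈ Icc 0 (s r), (r, z) ∈ U := fun z hz => hDU ⟨hr, hz⟩
  have hseg' : ∀ z ∈ Icc 0 (s r), (r, z) ∈ U' := fun z hz => hDU' ⟨hr, hz⟩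
  have hvr := contDiffOn_pr hU hvU
  have hvz := contDiffOn_pz hU hvU
  have hvzz := contDiffOn_pz hU hvz
  have hvzr := contDiffOn_pr hU hvz
  have hvzzr := contDiffOn_pr hU hvzz
  have hcβ := hβU.continuousOn_vertical hseg'
  have hcv := hvU.continuousOn_vertical hseg
  have hcvr := hvr.continuousOn_vertical hseg
  have hcvzz := hvzz.continuousOn_vertical hseg
  have hcvzzr := hvzzr.continuousOn_vertical hseg
  have huIcc : uIcc 0 (s r) = Icc 0 (s r) := uIcc_of_le hs0
  have hnorm : ContDiffOn ℝ 1 (fun p : ℝ × ℝ => ‖v p.1 p.2‖ ^ 2) U :=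
    (hvU.of_le (by simp)).norm_sq ℝ
  have hleib := hasDerivAt_integral_variable_upper (g := fun t z => ‖v t z‖ ^ 2) hU hnorm hs0 hseg
    (hs.differentiable (by simp) r).hasDerivAt
  have hvr0 : pr v r 0 = 0 := by
    have hzero : HasDerivWithinAt (fun t => v t 0) 0 (Icc 0 R) r :=
      (hasDerivWithinAt_const r (Icc 0 R) (0 : ℂ)).congr hsurf (hsurf r hr)
    exact (uniqueDiffOn_Icc hR r hr).eq_deriv _
      (hasDerivAt_pr hU hvU (hseg 0 ⟨le_rfl, hs0⟩)).hasDerivWithinAt hzero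
  have hflux : (∫ z in (0:ℝ)..(s r),
      ((q * pr (pz (pz v)) r z - I * lam * pz (pz v) r z)
        * (starRingEnd ℂ) (q * pr v r z - I * lam * v r z)).im)
      = ((q * pr (pz v) r (s r) - I * lam * pz v r (s r))
        * (starRingEnd ℂ) (q * pr v r (s r) - I * lam * v r (s r))).im := by
    have hftc := integral_eq_sub_of_hasDerivAt (a := 0) (b := s r)
      (f := fun z => ((q * pr (pz v) r z - I * lam * pz v r z)
        * (starRingEnd ℂ) (q * pr v r z - I * lam * v r z)).im)
      (f' := fun z => ((q * pr (pz (pz v)) r z - I * lam * pz (pz v) r z)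
        * (starRingEnd ℂ) (q * pr v r z - I * lam * v r z)).im) ?_ ?_
    · rw [hftc, hvr0, hsurf r hr]
      simp
    · intro z hz
      have hzU := hseg z (huIcc ▸ hz)
      have hF := ((hasDerivAt_pz hU hvr hzU).const_mul q).sub
        ((hasDerivAt_pz hU hvU hzU).const_mul (I * lam))
      have hFz := ((hasDerivAt_pz hU hvzr hzU).const_mul q).sub
        ((hasDerivAt_pz hU hvz hzU).const_mul (I * lam))
      rw [pz_pr_comm hU hvU hzU] at hF
      rw [pz_pr_comm hU hvz hzU] at hFz
      have hmul := imCLM.hasFDerivAt.comp_hasDerivAt z (hFz.mul hF.star)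
      refine hmul.congr_deriv ?_
      simp only [Pi.sub_apply, imCLM_apply, add_im, ← starRingEnd_apply]
      rw [mul_conj, ofReal_im, add_zero]
    · apply ContinuousOn.intervalIntegrable
      rw [huIcc]
      fun_prop
  have hdensity : (∫ z in (0:ℝ)..(s r), deriv (fun t => ‖v t z‖ ^ 2) r)
      = ∫ z in (0:ℝ)..(s r), (2 / lam * q.im * ‖pr v r z‖ ^ 2
        - 2 / lam * ((β r z).im * ‖q * pr v r z - I * lam * v r z‖ ^ 2)
        - 2 * α ^ 2 / lam * ((q * pr (pz (pz v)) r z - I * lam * pz (pz v) r z)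
          * (starRingEnd ℂ) (q * pr v r z - I * lam * v r z)).im) := by
    refine integral_congr fun z hz => ?_
    rw [huIcc] at hz
    rw [(hasDerivAt_pr hU hvU (hseg z hz)).norm_sq.deriv]
    exact energy_density_eq hlam (by linear_combination hpde r hr z hz)
  have hi1 : IntervalIntegrable (fun z => 2 / lam * q.im * ‖pr v r z‖ ^ 2) volume 0 (s r) := by
    apply ContinuousOn.intervalIntegrable
    rw [huIcc]
    fun_prop
  have hi2 : IntervalIntegrable (fun z => 2 / lam * ((β r z).im
      * ‖q * pr v r z - I * lam * v r z‖ ^ 2)) volume 0 (s r) := by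
    apply ContinuousOn.intervalIntegrable
    rw [huIcc]
    fun_prop
  have hi3 : IntervalIntegrable (fun z => 2 * α ^ 2 / lam
      * ((q * pr (pz (pz v)) r z - I * lam * pz (pz v) r z)
        * (starRingEnd ℂ) (q * pr v r z - I * lam * v r z)).im) volume 0 (s r) := by
    apply ContinuousOn.intervalIntegrable
    rw [huIcc]
    fun_prop
  rw [hdensity, integral_sub (hi1.sub hi2) hi3, integral_sub hi1 hi2] at hleib
  simp only [intervalIntegral.integral_const_mul] at hleib
  rw [hflux] at hleib
  exact (hleib.congr_deriv (by ring)).hasDerivWithinAt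
end

section
/- Suppose u ∈ C²([0,s];ℂ) satisfies (1/q + β(z))·u(z) + α²·u''(z) = 0 for all z ∈ [0,s] together with u(0) = u(s) = 0. If either (i) Im(1/q + β(z)) > 0 for all z ∈ [0,s], or Im(1/q + β(z)) < 0 for all z ∈ [0,s], or (ii) s²·max_{z∈[0,s]} |Re(1/q + β(z))| < α², then u is identically zero on [0,s]. -/
open Complex Set

/-- Cauchy–Schwarz against the constant function `1`, on an interval. -/
theorem sq_integral_le_length_mul_integral_sq {s : ℝ} (hs : 0 < s) {f : ℝ → ℝ}
    (hf : ContinuousOn f (Icc 0 s)) :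
    (∫ x in (0:ℝ)..s, f x) ^ 2 ≤ s * ∫ x in (0:ℝ)..s, f x ^ 2 := by
  have hfi : IntervalIntegrable f MeasureTheory.volume 0 s :=
    hf.intervalIntegrable_of_Icc hs.le
  have hf2 : IntervalIntegrable (fun x => f x ^ 2) MeasureTheory.volume 0 s :=
    (hf.pow 2).intervalIntegrable_of_Icc hs.le
  set A := ∫ x in (0:ℝ)..s, f x with hA
  have h0 : 0 ≤ ∫ x in (0:ℝ)..s, (s * f x - A) ^ 2 :=
    intervalIntegral.integral_nonneg hs.le fun x _ => sq_nonneg _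
  have h1 : ∫ x in (0:ℝ)..s, (s * f x - A) ^ 2
      = s ^ 2 * (∫ x in (0:ℝ)..s, f x ^ 2) - 2 * s * A * A + s * A ^ 2 := by
    have : ∀ x, (s * f x - A) ^ 2 = s ^ 2 * f x ^ 2 - 2 * s * A * f x + A ^ 2 := fun x => by ring
    simp_rw [this]
    rw [intervalIntegral.integral_add ((hf2.const_mul _).sub (hfi.const_mul _))
        intervalIntegrable_const,
      intervalIntegral.integral_sub (hf2.const_mul _) (hfi.const_mul _),
      intervalIntegral.integral_const_mul, intervalIntegral.integral_const_mul,
      intervalIntegral.integral_const]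
    simp [hA]
  rw [h1] at h0
  have : 0 ≤ s * (s * (∫ x in (0:ℝ)..s, f x ^ 2) - A ^ 2) := by linarith
  linarith [nonneg_of_mul_nonneg_right this hs]

/-- A function vanishing at `0` is bounded pointwise by the `L²` norm of its derivative. -/
theorem norm_sq_le_mul_integral_norm_deriv_sq {s : ℝ} (hs : 0 < s) {u v : ℝ → ℂ}
    (hu : ContinuousOn u (Icc 0 s)) (hv : ContinuousOn v (Icc 0 s))
    (huv : ∀ x ∈ Ioo 0 s, HasDerivAt u (v x) x) (hu0 : u 0 = 0) :
    ∀ z ∈ Icc 0 s, ‖u z‖ ^ 2 ≤ s * ∫ x in (0:ℝ)..s, ‖v x‖ ^ 2 := by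
  intro z hz
  have hsub : Icc 0 z ⊆ Icc 0 s := Icc_subset_Icc_right hz.2
  have hint : ∫ x in (0:ℝ)..z, v x = u z := by
    rw [intervalIntegral.integral_eq_sub_of_hasDerivAt_of_le hz.1 (hu.mono hsub)
      (fun x hx => huv x ⟨hx.1, hx.2.trans_le hz.2⟩)
      ((hv.mono hsub).intervalIntegrable_of_Icc hz.1), hu0, sub_zero]
  have hle : ‖u z‖ ≤ ∫ x in (0:ℝ)..s, ‖v x‖ := by
    rw [← hint]
    refine (intervalIntegral.norm_integral_le_integral_norm hz.1).trans ?_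
    exact intervalIntegral.integral_mono_interval le_rfl hz.1 hz.2
      (Filter.Eventually.of_forall fun x => norm_nonneg _)
      (hv.norm.intervalIntegrable_of_Icc hs.le)
  exact (pow_le_pow_left₀ (norm_nonneg _) hle 2).trans
    (sq_integral_le_length_mul_integral_sq hs hv.norm)

/-- The energy identity for `c u + a u'' = 0` with Dirichlet boundary conditions. -/
theorem integral_energy_eq_zero {s : ℝ} (hs : 0 < s) {a : ℂ} {c u v w : ℝ → ℂ}
    (hu : ContinuousOn u (Icc 0 s)) (hv : ContinuousOn v (Icc 0 s))
    (hc : ContinuousOn c (Icc 0 s))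
    (huv : ∀ x ∈ Ioo 0 s, HasDerivAt u (v x) x) (hvw : ∀ x ∈ Ioo 0 s, HasDerivAt v (w x) x)
    (hode : ∀ x ∈ Icc 0 s, c x * u x + a * w x = 0) (hu0 : u 0 = 0) (hus : u s = 0) :
    ∫ x in (0:ℝ)..s, (a * ((‖v x‖ ^ 2 : ℝ) : ℂ) - c x * ((‖u x‖ ^ 2 : ℝ) : ℂ)) = 0 := by
  have hconj : ContinuousOn (fun x => star (u x)) (Icc 0 s) := hu.star
  rw [intervalIntegral.integral_eq_sub_of_hasDerivAt_of_le (f := fun x => a * (v x * star (u x)))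
    hs.le (continuousOn_const.mul (hv.mul hconj))]
  · simp [hu0, hus]
  · intro x hx
    refine (((hvw x hx).mul (huv x hx).star).const_mul a).congr_deriv ?_
    have h1 := hode x (Ioo_subset_Icc_self hx)
    have h2 := Complex.mul_conj' (v x)
    have h3 := Complex.mul_conj' (u x)
    simp only [← starRingEnd_apply] at *
    push_cast
    linear_combination (starRingEnd ℂ (u x)) * h1 + a * h2 - c x * h3
  · refine ContinuousOn.intervalIntegrable_of_Icc hs.le ?_
    have hvn : ContinuousOn (fun x => ((‖v x‖ ^ 2 : ℝ) : ℂ)) (Icc 0 s) :=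
      Complex.continuous_ofReal.comp_continuousOn (hv.norm.pow 2)
    have hun : ContinuousOn (fun x => ((‖u x‖ ^ 2 : ℝ) : ℂ)) (Icc 0 s) :=
      Complex.continuous_ofReal.comp_continuousOn (hu.norm.pow 2)
    exact (continuousOn_const.mul hvn).sub (hc.mul hun)

/-- A continuous positive weight against `‖u‖²` has nonzero integral unless `u` vanishes. -/
theorem eq_zero_of_integral_mul_norm_sq_eq_zero {s : ℝ} (hs : 0 < s) {p : ℝ → ℝ} {u : ℝ → ℂ}
    (hp : ContinuousOn p (Icc 0 s)) (hu : ContinuousOn u (Icc 0 s))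
    (hpos : ∀ x ∈ Icc 0 s, 0 < p x) (hint : ∫ x in (0:ℝ)..s, p x * ‖u x‖ ^ 2 = 0) :
    ∀ z ∈ Icc 0 s, u z = 0 := by
  by_contra! h
  obtain ⟨z, hz, hne⟩ := h
  refine (intervalIntegral.integral_pos hs (hp.mul (hu.norm.pow 2)) (fun x hx => ?_)
    ⟨z, hz, ?_⟩).ne' hint
  · exact mul_nonneg (hpos x (Ioc_subset_Icc_self hx)).le (sq_nonneg _)
  · exact mul_pos (hpos z hz) (pow_pos (norm_pos_iff.mpr hne) 2)


/-- If `u ∈ C²([0,s];ℂ)` satisfies `(1/q + β(z))·u(z) + α²·u''(z) = 0` on `[0,s]`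
with `u(0) = u(s) = 0`, and either (i) `Im(1/q + β)` is of one sign on `[0,s]`,
or (ii) `s² · max_{[0,s]} |Re(1/q + β)| < α²`, then `u ≡ 0` on `[0,s]`. -/
theorem stmt_6 (s α : ℝ) (q : ℂ) (β : ℝ → ℂ) (hs : 0 < s) (hα : 0 < α) (hq : q ≠ 0)
    (hβ : ContinuousOn β (Icc 0 s))
    (u : ℝ → ℂ) (hu : ContDiffOn ℝ 2 u (Icc 0 s))
    (hode : ∀ z ∈ Icc (0:ℝ) s,
      (1 / q + β z) * u z + (α : ℂ) ^ 2 * iteratedDerivWithin 2 u (Icc 0 s) z = 0)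
    (hu0 : u 0 = 0) (hus : u s = 0)
    (hcond :
      ((∀ z ∈ Icc (0:ℝ) s, 0 < (1 / q + β z).im) ∨ (∀ z ∈ Icc (0:ℝ) s, (1 / q + β z).im < 0))
      ∨ (∃ M : ℝ, (∀ z ∈ Icc (0:ℝ) s, |(1 / q + β z).re| ≤ M) ∧ s ^ 2 * M < α ^ 2)) :
    ∀ z ∈ Icc (0:ℝ) s, u z = 0 := by
  set I := Icc (0:ℝ) s with hI
  set v := derivWithin u I with hv_def
  set c : ℝ → ℂ := fun z => 1 / q + β z with hc_def
  have hud : UniqueDiffOn ℝ I := uniqueDiffOn_Icc hs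
  have hv1 : ContDiffOn ℝ 1 v I := hu.derivWithin hud (by norm_num)
  have hvc : ContinuousOn v I := hv1.continuousOn
  have huc : ContinuousOn u I := hu.continuousOn
  have hcc : ContinuousOn c I := continuousOn_const.add hβ
  have huv : ∀ x ∈ Ioo 0 s, HasDerivAt u (v x) x := fun x hx =>
    ((hu.differentiableOn (by norm_num)) x
      (Ioo_subset_Icc_self hx)).hasDerivWithinAt.hasDerivAt (Icc_mem_nhds hx.1 hx.2)
  have hvw : ∀ x ∈ Ioo 0 s, HasDerivAt v (iteratedDerivWithin 2 u I x) x := fun x hx => by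
    have h := ((hv1.differentiableOn (by norm_num)) x
      (Ioo_subset_Icc_self hx)).hasDerivWithinAt.hasDerivAt (Icc_mem_nhds hx.1 hx.2)
    have h2 : iteratedDerivWithin 2 u I x = derivWithin v I x := by
      rw [iteratedDerivWithin_succ, iteratedDerivWithin_one]
    rwa [h2]
  have hE := integral_energy_eq_zero hs huc hvc hcc huv hvw hode hu0 hus
  have hEint : IntervalIntegrable
      (fun x => (α : ℂ) ^ 2 * ((‖v x‖ ^ 2 : ℝ) : ℂ) - c x * ((‖u x‖ ^ 2 : ℝ) : ℂ))
      MeasureTheory.volume 0 s :=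
    ((continuousOn_const.mul (Complex.continuous_ofReal.comp_continuousOn (hvc.norm.pow 2))).sub
      (hcc.mul (Complex.continuous_ofReal.comp_continuousOn
        (huc.norm.pow 2)))).intervalIntegrable_of_Icc hs.le
  have him : ∫ x in (0:ℝ)..s, (c x).im * ‖u x‖ ^ 2 = 0 := by
    have h := Complex.imCLM.intervalIntegral_comp_comm hEint
    rw [hE, map_zero] at h
    rw [← neg_eq_zero, ← intervalIntegral.integral_neg]
    refine (intervalIntegral.integral_congr fun x _ => ?_).trans h
    simp only [Complex.imCLM_apply, Complex.sub_im, Complex.im_mul_ofReal, ← Complex.ofReal_pow,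
      Complex.ofReal_im]
    ring
  have hcim : ContinuousOn (fun x => (c x).im) I := Complex.continuous_im.comp_continuousOn hcc
  rcases hcond with (hpos | hneg) | ⟨M, hM, hMs⟩
  · exact eq_zero_of_integral_mul_norm_sq_eq_zero hs hcim huc hpos him
  · refine eq_zero_of_integral_mul_norm_sq_eq_zero hs hcim.neg huc
      (fun x hx => neg_pos.mpr (hneg x hx)) ?_
    simpa [neg_mul] using him
  · have hvi : IntervalIntegrable (fun x => ‖v x‖ ^ 2) MeasureTheory.volume 0 s :=
      (hvc.norm.pow 2).intervalIntegrable_of_Icc hs.le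
    have hcui : IntervalIntegrable (fun x => (c x).re * ‖u x‖ ^ 2) MeasureTheory.volume 0 s :=
      ((Complex.continuous_re.comp_continuousOn hcc).mul
        (huc.norm.pow 2)).intervalIntegrable_of_Icc hs.le
    have hre : α ^ 2 * (∫ x in (0:ℝ)..s, ‖v x‖ ^ 2) = ∫ x in (0:ℝ)..s, (c x).re * ‖u x‖ ^ 2 := by
      have h := Complex.reCLM.intervalIntegral_comp_comm hEint
      rw [hE, map_zero] at h
      rw [← sub_eq_zero, ← intervalIntegral.integral_const_mul,
        ← intervalIntegral.integral_sub (hvi.const_mul _) hcui]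
      refine (intervalIntegral.integral_congr fun x _ => ?_).trans h
      simp only [Complex.reCLM_apply, Complex.sub_re, Complex.re_mul_ofReal, ← Complex.ofReal_pow,
        Complex.ofReal_re]
    have hpt := norm_sq_le_mul_integral_norm_deriv_sq hs huc hvc huv hu0
    set D := ∫ x in (0:ℝ)..s, ‖v x‖ ^ 2 with hD
    have hD0 : 0 ≤ D := intervalIntegral.integral_nonneg hs.le fun x _ => sq_nonneg _
    have hM0 : 0 ≤ M := (abs_nonneg _).trans (hM 0 ⟨le_rfl, hs.le⟩)
    have hle : ∫ x in (0:ℝ)..s, (c x).re * ‖u x‖ ^ 2 ≤ ∫ _ in (0:ℝ)..s, M * (s * D) :=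
      intervalIntegral.integral_mono_on hs.le hcui intervalIntegrable_const fun x hx =>
        mul_le_mul ((le_abs_self _).trans (hM x hx)) (hpt x hx) (sq_nonneg _) hM0
    rw [← hre, intervalIntegral.integral_const, smul_eq_mul, sub_zero] at hle
    have hDz : D = 0 := by
      by_contra hne
      have := mul_lt_mul_of_pos_right hMs (lt_of_le_of_ne hD0 (Ne.symm hne))
      nlinarith
    intro z hz
    have h := hpt z hz
    rw [hDz, mul_zero] at h
    exact norm_eq_zero.mp (pow_eq_zero_iff two_ne_zero |>.mp (le_antisymm h (sq_nonneg _)))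
end

section
/- Assume there is C_PF > 0 such that ∫₀¹ |w(y)|² dy ≤ C_PF²·∫₀¹ |w'(y)|² dy for every w ∈ C¹([0,1];ℂ) with w(0) = w(1) = 0 (Poincaré–Friedrichs inequality). If C_EB := min_{y∈[0,1]} [ 1/C_PF² − (s²/(α²·|q|²))·(Re(q) + |q|²·Re(γ(y))) ] > 0, then Re (Λv, v)_{0,I} ≥ C_EB·∫₀¹ |v(y)|² dy for every v ∈ C²([0,1];ℂ) with v(0) = v(1) = 0. -/
open Complex Set intervalIntegral

/-- Integration by parts on `[0,1]`: if `v` is `C²` and vanishes at both endpoints, then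
`∫ -v'' · conj v = ∫ |v'|²`. -/
theorem integral_neg_iteratedDerivWithin_two_mul_conj {v : ℝ → ℂ}
    (hv : ContDiffOn ℝ 2 v (Icc 0 1)) (h0 : v 0 = 0) (h1 : v 1 = 0) :
    (∫ y in (0:ℝ)..1, -(iteratedDerivWithin 2 v (Icc 0 1) y) * (starRingEnd ℂ) (v y))
      = ((∫ y in (0:ℝ)..1, ‖derivWithin v (Icc 0 1) y‖ ^ 2 : ℝ) : ℂ) := by
  have hu : UniqueDiffOn ℝ (Icc (0:ℝ) 1) := uniqueDiffOn_Icc zero_lt_one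
  have hI : uIcc (0:ℝ) 1 = Icc 0 1 := uIcc_of_le zero_le_one
  have hd : ContDiffOn ℝ 1 (derivWithin v (Icc 0 1)) (Icc 0 1) :=
    hv.derivWithin hu (by norm_num)
  have h2 : iteratedDerivWithin 2 v (Icc 0 1)
      = derivWithin (derivWithin v (Icc 0 1)) (Icc 0 1) := by
    rw [iteratedDerivWithin_succ, iteratedDerivWithin_one]
  have hc2 : ContinuousOn (derivWithin (derivWithin v (Icc 0 1)) (Icc 0 1)) (Icc 0 1) :=
    hd.continuousOn_derivWithin hu le_rfl
  have hcv : ContinuousOn (fun y => (starRingEnd ℂ) (v y)) (Icc 0 1) :=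
    Complex.continuous_conj.comp_continuousOn hv.continuousOn
  have hcd : ContinuousOn (fun y => (starRingEnd ℂ) (derivWithin v (Icc 0 1) y)) (Icc 0 1) :=
    Complex.continuous_conj.comp_continuousOn hd.continuousOn
  have key := integral_deriv_mul_eq_sub_of_hasDerivWithinAt (a := (0:ℝ)) (b := 1)
    (u := derivWithin v (Icc 0 1)) (v := fun y => (starRingEnd ℂ) (v y))
    (u' := derivWithin (derivWithin v (Icc 0 1)) (Icc 0 1))
    (v' := fun y => (starRingEnd ℂ) (derivWithin v (Icc 0 1) y))
    (fun y hy => by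
      rw [hI] at hy ⊢
      exact (hd.differentiableOn one_ne_zero y hy).hasDerivWithinAt)
    (fun y hy => by
      rw [hI] at hy ⊢
      exact (hv.differentiableOn two_ne_zero y hy).hasDerivWithinAt.star)
    (hc2.intervalIntegrable_of_Icc zero_le_one)
    (hcd.intervalIntegrable_of_Icc zero_le_one)
  rw [integral_add ((hc2.fun_mul hcv).intervalIntegrable_of_Icc zero_le_one)
    ((hd.continuousOn.fun_mul hcd).intervalIntegrable_of_Icc zero_le_one)] at key
  simp only [h0, h1, map_zero, mul_zero, sub_zero, Complex.mul_conj'] at key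
  rw [← intervalIntegral.integral_ofReal, h2]
  simp only [neg_mul, intervalIntegral.integral_neg, ofReal_pow]
  linear_combination -key

/-- The real part of the zeroth-order coefficient of `Λ`. -/
theorem re_one_add_mul_mul_sq_div (s α : ℝ) {q : ℂ} (hq : q ≠ 0) (g : ℂ) :
    ((1 + q * g) * (s : ℂ) ^ 2 / ((α : ℂ) ^ 2 * q)).re
      = s ^ 2 / (α ^ 2 * ‖q‖ ^ 2) * (q.re + ‖q‖ ^ 2 * g.re) := by
  have hn : ‖q‖ ≠ 0 := norm_ne_zero_iff.mpr hq
  have h : (1 + q * g) * (s : ℂ) ^ 2 / ((α : ℂ) ^ 2 * q)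
      = ((s ^ 2 / α ^ 2 : ℝ) : ℂ) * (q⁻¹ + g) := by
    push_cast
    rcases eq_or_ne (α : ℂ) 0 with h | h
    · simp [h]
    · field_simp
  rw [h, re_ofReal_mul, add_re, inv_re, normSq_eq_norm_sq]
  rcases eq_or_ne α 0 with h | h
  · simp [h]
  · field_simp

/-- If the Poincaré–Friedrichs inequality holds on `[0,1]` with constant
`C_PF > 0`, and `C_EB := min_{[0,1]} [1/C_PF² - (s²/(α²|q|²))·(Re q + |q|² Re γ)] > 0`,
then `Re (Λv, v)_{0,I} ≥ C_EB ∫₀¹ |v|² dy` for all `v ∈ C²([0,1];ℂ)` with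
`v(0) = v(1) = 0`, where `(Λv)(y) = -v''(y) - ((1 + q·γ(y))·s²/(α²·q))·v(y)`. -/
theorem stmt_8 (s α : ℝ) (q : ℂ) (γ : ℝ → ℂ) (hs : 0 < s) (hα : 0 < α) (hq : q ≠ 0)
    (hγ : ContinuousOn γ (Icc 0 1))
    (CPF : ℝ) (hCPF : 0 < CPF)
    (hPF : ∀ w : ℝ → ℂ, ContDiffOn ℝ 1 w (Icc 0 1) → w 0 = 0 → w 1 = 0 →
      (∫ y in (0:ℝ)..1, ‖w y‖ ^ 2) ≤ CPF ^ 2 * ∫ y in (0:ℝ)..1, ‖derivWithin w (Icc 0 1) y‖ ^ 2)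
    (CEB : ℝ) (hCEB : 0 < CEB)
    (hmin : ∀ y ∈ Icc (0:ℝ) 1,
      CEB ≤ 1 / CPF ^ 2 - (s ^ 2 / (α ^ 2 * ‖q‖ ^ 2)) * (q.re + ‖q‖ ^ 2 * (γ y).re)) :
    ∀ v : ℝ → ℂ, ContDiffOn ℝ 2 v (Icc 0 1) → v 0 = 0 → v 1 = 0 →
      CEB * ∫ y in (0:ℝ)..1, ‖v y‖ ^ 2
        ≤ (∫ y in (0:ℝ)..1,
            (-(iteratedDerivWithin 2 v (Icc 0 1) y)
              - ((1 + q * γ y) * (s : ℂ) ^ 2 / ((α : ℂ) ^ 2 * q)) * v y)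
              * (starRingEnd ℂ) (v y)).re := by
  intro v hv h0 h1
  have hu : UniqueDiffOn ℝ (Icc (0:ℝ) 1) := uniqueDiffOn_Icc zero_lt_one
  set c : ℝ → ℂ := fun y => (1 + q * γ y) * (s : ℂ) ^ 2 / ((α : ℂ) ^ 2 * q) with hc
  have hcc : ContinuousOn c (Icc 0 1) :=
    ((continuousOn_const.add (continuousOn_const.mul hγ)).mul continuousOn_const).div_const _
  have hcv : ContinuousOn (fun y => (starRingEnd ℂ) (v y)) (Icc 0 1) :=
    Complex.continuous_conj.comp_continuousOn hv.continuousOn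
  have hn : ContinuousOn (fun y => ‖v y‖ ^ 2) (Icc 0 1) := hv.continuousOn.norm.pow 2
  have hi1 : IntervalIntegrable
      (fun y => -(iteratedDerivWithin 2 v (Icc 0 1) y) * (starRingEnd ℂ) (v y))
      MeasureTheory.volume 0 1 :=
    ContinuousOn.intervalIntegrable_of_Icc zero_le_one
      ((hv.continuousOn_iteratedDerivWithin le_rfl hu).neg.mul hcv)
  have hi2 : IntervalIntegrable (fun y => c y * (‖v y‖ ^ 2 : ℝ)) MeasureTheory.volume 0 1 :=
    ContinuousOn.intervalIntegrable_of_Icc zero_le_one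
      (hcc.mul (Complex.continuous_ofReal.comp_continuousOn hn))
  have hsplit : (∫ y in (0:ℝ)..1, (-(iteratedDerivWithin 2 v (Icc 0 1) y) - c y * v y)
      * (starRingEnd ℂ) (v y))
      = ((∫ y in (0:ℝ)..1, ‖derivWithin v (Icc 0 1) y‖ ^ 2 : ℝ) : ℂ)
        - ∫ y in (0:ℝ)..1, c y * (‖v y‖ ^ 2 : ℝ) := by
    rw [← integral_neg_iteratedDerivWithin_two_mul_conj hv h0 h1, ← integral_sub hi1 hi2]
    congr 1 with y
    rw [sub_mul, mul_assoc (c y), Complex.mul_conj', ofReal_pow]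
  have hre : (∫ y in (0:ℝ)..1, c y * (‖v y‖ ^ 2 : ℝ)).re
      = ∫ y in (0:ℝ)..1, (c y).re * ‖v y‖ ^ 2 := by
    have := Complex.reCLM.intervalIntegral_comp_comm hi2
    simp only [Complex.reCLM_apply, re_mul_ofReal] at this
    exact this.symm
  have hpot : (∫ y in (0:ℝ)..1, (c y).re * ‖v y‖ ^ 2)
      ≤ ∫ y in (0:ℝ)..1, (1 / CPF ^ 2 - CEB) * ‖v y‖ ^ 2 := by
    refine integral_mono_on zero_le_one
      (ContinuousOn.intervalIntegrable_of_Icc zero_le_one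
        ((Complex.continuous_re.comp_continuousOn hcc).mul hn))
      ((continuousOn_const.mul hn).intervalIntegrable_of_Icc zero_le_one) fun y hy => ?_
    have := hmin y hy
    rw [← re_one_add_mul_mul_sq_div s α hq] at this
    exact mul_le_mul_of_nonneg_right (by linarith) (by positivity)
  rw [intervalIntegral.integral_const_mul, sub_mul] at hpot
  have hP : 1 / CPF ^ 2 * (∫ y in (0:ℝ)..1, ‖v y‖ ^ 2)
      ≤ ∫ y in (0:ℝ)..1, ‖derivWithin v (Icc 0 1) y‖ ^ 2 := by
    rw [one_div, inv_mul_le_iff₀ (by positivity)]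
    exact hPF v (hv.of_le (by norm_num)) h0 h1
  rw [hsplit, sub_re, ofReal_re, hre]
  linarith
end

section
/- Suppose there exists δ* ∈ {1,−1} such that C_BB := min_{y∈[0,1]} [ δ*·(s²/(α²·|q|²))·(Im(q) − |q|²·Im(γ(y))) ] > 0. Then |Im (Λv, v)_{0,I}| ≥ C_BB·∫₀¹ |v(y)|² dy for every v ∈ C²([0,1];ℂ) with v(0) = v(1) = 0. -/
open Complex Set intervalIntegral

/-- For `v` twice continuously differentiable on `[0,1]` and vanishing at the endpoints, `∫ v'' v̄`
is real. -/
theorem integral_im_iteratedDerivWithin_two_mul_conj_eq_zero {v : ℝ → ℂ}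
    (hv : ContDiffOn ℝ 2 v (Icc 0 1)) (h0 : v 0 = 0) (h1 : v 1 = 0) :
    ∫ y in (0:ℝ)..1,
      (iteratedDerivWithin 2 v (Icc 0 1) y * (starRingEnd ℂ) (v y)).im = 0 := by
  have hu : UniqueDiffOn ℝ (Icc (0:ℝ) 1) := uniqueDiffOn_Icc one_pos
  have hc1 : ContinuousOn (iteratedDerivWithin 1 v (Icc 0 1)) (Icc 0 1) :=
    hv.continuousOn_iteratedDerivWithin (by norm_num) hu
  have hc2 : ContinuousOn (iteratedDerivWithin 2 v (Icc 0 1)) (Icc 0 1) :=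
    hv.continuousOn_iteratedDerivWithin le_rfl hu
  have hd1 : DifferentiableOn ℝ (iteratedDerivWithin 1 v (Icc 0 1)) (Icc 0 1) :=
    hv.differentiableOn_iteratedDerivWithin (by norm_num) hu
  have hstar : ContinuousOn (fun y => (starRingEnd ℂ) (v y)) (Icc 0 1) :=
    Complex.continuous_conj.comp_continuousOn hv.continuousOn
  have key := integral_eq_sub_of_hasDerivAt_of_le (a := (0:ℝ)) (b := 1) zero_le_one
    (f := fun y => (iteratedDerivWithin 1 v (Icc 0 1) y * (starRingEnd ℂ) (v y)).im)
    (f' := fun y => (iteratedDerivWithin 2 v (Icc 0 1) y * (starRingEnd ℂ) (v y)).im)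
    (Complex.continuous_im.comp_continuousOn (hc1.mul hstar)) ?_ ?_
  · simpa [h0, h1] using key
  · intro y hy
    have hn : Icc (0:ℝ) 1 ∈ nhds y := Icc_mem_nhds hy.1 hy.2
    have hyI : y ∈ Icc (0:ℝ) 1 := Ioo_subset_Icc_self hy
    have hv' : HasDerivAt v (iteratedDerivWithin 1 v (Icc 0 1) y) y := by
      rw [iteratedDerivWithin_one]
      exact ((hv.differentiableOn (by norm_num)) y hyI).hasDerivWithinAt.hasDerivAt hn
    have hw' : HasDerivAt (iteratedDerivWithin 1 v (Icc 0 1))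
        (iteratedDerivWithin 2 v (Icc 0 1) y) y := by
      rw [iteratedDerivWithin_succ (n := 1)]
      exact (hd1 y hyI).hasDerivWithinAt.hasDerivAt hn
    have him := Complex.imCLM.hasFDerivAt.comp_hasDerivAt y (hw'.mul hv'.star)
    refine him.congr_deriv ?_
    have hreal : (iteratedDerivWithin 1 v (Icc 0 1) y
        * (starRingEnd ℂ) (iteratedDerivWithin 1 v (Icc 0 1) y)).im = 0 := by
      rw [Complex.mul_conj, Complex.ofReal_im]
    simp only [← starRingEnd_apply]
    rw [Complex.imCLM_apply, Complex.add_im, hreal, add_zero]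
  · apply ContinuousOn.intervalIntegrable
    rw [uIcc_of_le zero_le_one]
    exact Complex.continuous_im.comp_continuousOn (hc2.mul hstar)

/-- The imaginary part of the potential `(1 + q c) s² / (α² q)`. -/
theorem im_potential (s α : ℝ) {q : ℂ} (c : ℂ) (hq : q ≠ 0) :
    ((1 + q * c) * (s : ℂ) ^ 2 / ((α : ℂ) ^ 2 * q)).im
      = -(s ^ 2 / (α ^ 2 * ‖q‖ ^ 2) * (q.im - ‖q‖ ^ 2 * c.im)) := by
  have hn : ‖q‖ ≠ 0 := norm_ne_zero_iff.mpr hq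
  have hsplit : (1 + q * c) * (s : ℂ) ^ 2 / ((α : ℂ) ^ 2 * q)
      = ((s ^ 2 / α ^ 2 : ℝ) : ℂ) * (q⁻¹ + c) := by
    push_cast
    rw [div_mul_eq_div_div_swap, mul_div_right_comm, add_div, mul_div_cancel_left₀ _ hq, one_div]
    ring
  rw [hsplit, Complex.im_ofReal_mul, Complex.add_im, Complex.inv_im, Complex.normSq_eq_norm_sq]
  rw [mul_comm (α ^ 2), ← div_div]
  field_simp
  ring

/-- If there is `δ* ∈ {1, -1}` with
`C_BB := min_{[0,1]} [δ*·(s²/(α²|q|²))·(Im q - |q|² Im γ)] > 0`, then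
`|Im (Λv, v)_{0,I}| ≥ C_BB ∫₀¹ |v|² dy` for all `v ∈ C²([0,1];ℂ)` with
`v(0) = v(1) = 0`, where `(Λv)(y) = -v''(y) - ((1 + q·γ(y))·s²/(α²·q))·v(y)`. -/
theorem stmt_9 (s α : ℝ) (q : ℂ) (γ : ℝ → ℂ) (hs : 0 < s) (hα : 0 < α) (hq : q ≠ 0)
    (hγ : ContinuousOn γ (Icc 0 1))
    (δstar : ℝ) (hδstar : δstar = 1 ∨ δstar = -1)
    (CBB : ℝ) (hCBB : 0 < CBB)
    (hmin : ∀ y ∈ Icc (0:ℝ) 1,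
      CBB ≤ δstar * (s ^ 2 / (α ^ 2 * ‖q‖ ^ 2)) * (q.im - ‖q‖ ^ 2 * (γ y).im)) :
    ∀ v : ℝ → ℂ, ContDiffOn ℝ 2 v (Icc 0 1) → v 0 = 0 → v 1 = 0 →
      CBB * ∫ y in (0:ℝ)..1, ‖v y‖ ^ 2
        ≤ |(∫ y in (0:ℝ)..1,
            (-(iteratedDerivWithin 2 v (Icc 0 1) y)
              - ((1 + q * γ y) * (s : ℂ) ^ 2 / ((α : ℂ) ^ 2 * q)) * v y)
              * (starRingEnd ℂ) (v y)).im| := by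
  intro v hv h0 h1
  have hu : UniqueDiffOn ℝ (Icc (0:ℝ) 1) := uniqueDiffOn_Icc one_pos
  have hcv := hv.continuousOn
  have hc2 : ContinuousOn (iteratedDerivWithin 2 v (Icc 0 1)) (Icc 0 1) :=
    hv.continuousOn_iteratedDerivWithin le_rfl hu
  have hstar : ContinuousOn (fun y => (starRingEnd ℂ) (v y)) (Icc 0 1) :=
    Complex.continuous_conj.comp_continuousOn hcv
  have hF : ContinuousOn (fun y => (-(iteratedDerivWithin 2 v (Icc 0 1) y)
      - ((1 + q * γ y) * (s : ℂ) ^ 2 / ((α : ℂ) ^ 2 * q)) * v y)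
      * (starRingEnd ℂ) (v y)) (Icc 0 1) :=
    (hc2.neg.sub (((((continuousOn_const.add (continuousOn_const.mul hγ)).mul
      continuousOn_const).div_const _)).mul hcv)).mul hstar
  have hii {E : Type} [NormedAddCommGroup E] {f : ℝ → E} (hf : ContinuousOn f (Icc 0 1)) :
      IntervalIntegrable f MeasureTheory.volume 0 1 :=
    ContinuousOn.intervalIntegrable (by rwa [uIcc_of_le zero_le_one])
  set B : ℝ → ℝ := fun y => s ^ 2 / (α ^ 2 * ‖q‖ ^ 2) * (q.im - ‖q‖ ^ 2 * (γ y).im)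
  have hB : ContinuousOn B (Icc 0 1) :=
    continuousOn_const.mul (continuousOn_const.sub
      (continuousOn_const.mul (Complex.continuous_im.comp_continuousOn hγ)))
  have hBv : ContinuousOn (fun y => B y * ‖v y‖ ^ 2) (Icc 0 1) := hB.mul (hcv.norm.pow 2)
  have him : (∫ y in (0:ℝ)..1, (-(iteratedDerivWithin 2 v (Icc 0 1) y)
      - ((1 + q * γ y) * (s : ℂ) ^ 2 / ((α : ℂ) ^ 2 * q)) * v y) * (starRingEnd ℂ) (v y)).im
      = ∫ y in (0:ℝ)..1, B y * ‖v y‖ ^ 2 := by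
    refine (Complex.imCLM.intervalIntegral_comp_comm (hii hF)).symm.trans ?_
    have hpt : ∀ y, Complex.imCLM ((-(iteratedDerivWithin 2 v (Icc 0 1) y)
        - ((1 + q * γ y) * (s : ℂ) ^ 2 / ((α : ℂ) ^ 2 * q)) * v y) * (starRingEnd ℂ) (v y))
        = B y * ‖v y‖ ^ 2
          - (iteratedDerivWithin 2 v (Icc 0 1) y * (starRingEnd ℂ) (v y)).im := by
      intro y
      rw [sub_mul, mul_assoc, Complex.mul_conj, Complex.imCLM_apply, Complex.sub_im,
        Complex.im_mul_ofReal, im_potential s α (γ y) hq, Complex.normSq_eq_norm_sq, neg_mul,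
        Complex.neg_im]
      ring
    simp_rw [hpt]
    have hG : ContinuousOn
        (fun y => (iteratedDerivWithin 2 v (Icc 0 1) y * (starRingEnd ℂ) (v y)).im) (Icc 0 1) :=
      Complex.continuous_im.comp_continuousOn (hc2.mul hstar)
    rw [intervalIntegral.integral_sub (hii hBv) (hii hG),
      integral_im_iteratedDerivWithin_two_mul_conj_eq_zero hv h0 h1, sub_zero]
  have hle : CBB * ∫ y in (0:ℝ)..1, ‖v y‖ ^ 2
      ≤ δstar * ∫ y in (0:ℝ)..1, B y * ‖v y‖ ^ 2 := by
    rw [← intervalIntegral.integral_const_mul, ← intervalIntegral.integral_const_mul]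
    refine intervalIntegral.integral_mono_on zero_le_one
      (hii (continuousOn_const.mul (hcv.norm.pow 2))) (hii (continuousOn_const.mul hBv)) ?_
    intro y hy
    have := mul_le_mul_of_nonneg_right (hmin y hy) (sq_nonneg ‖v y‖)
    simpa only [B, mul_assoc] using this
  rw [him]
  refine hle.trans ?_
  rcases hδstar with rfl | rfl
  · rw [one_mul]
    exact le_abs_self _
  · rw [neg_one_mul]
    exact neg_le_abs _
end

section
/- Discrete Poincaré–Friedrichs inequality: for every v ∈ X_h there holds ‖v‖_{0,h} ≤ (√2/2)·|v|_{1,h}. -/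
open Finset Complex

/-- A sequence starting at zero is controlled by its increments. -/
theorem norm_sq_le_mul_sum_norm_sub_sq {E : Type*} [SeminormedAddCommGroup E] (v : ℕ → E)
    (hv0 : v 0 = 0) (n : ℕ) :
    ‖v n‖ ^ 2 ≤ n * ∑ i ∈ Finset.range n, ‖v (i + 1) - v i‖ ^ 2 := by
  have h : ‖v n‖ ≤ ∑ i ∈ Finset.range n, ‖v (i + 1) - v i‖ := by
    have := norm_sum_le (Finset.range n) (fun i => v (i + 1) - v i)
    rwa [Finset.sum_range_sub, hv0, sub_zero] at this
  calc ‖v n‖ ^ 2 ≤ (∑ i ∈ Finset.range n, ‖v (i + 1) - v i‖) ^ 2 := by gcongr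
    _ ≤ n * ∑ i ∈ Finset.range n, ‖v (i + 1) - v i‖ ^ 2 := by
      simpa using sq_sum_le_card_mul_sum_sq (s := Finset.range n)
        (f := fun i => ‖v (i + 1) - v i‖)

theorem sum_range_natCast_le (n : ℕ) :
    ∑ j ∈ Finset.range n, (j : ℝ) ≤ (n : ℝ) ^ 2 / 2 := by
  induction n with
  | zero => simp
  | succ n ih => rw [Finset.sum_range_succ]; push_cast; linarith

/-- Summed form of the discrete Poincaré–Friedrichs inequality. -/
theorem sum_norm_sq_le_sum_norm_sub_sq {E : Type*} [SeminormedAddCommGroup E] (v : ℕ → E)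
    (hv0 : v 0 = 0) (n : ℕ) :
    ∑ j ∈ Finset.range n, ‖v j‖ ^ 2
      ≤ (n : ℝ) ^ 2 / 2 * ∑ i ∈ Finset.range n, ‖v (i + 1) - v i‖ ^ 2 := by
  calc ∑ j ∈ Finset.range n, ‖v j‖ ^ 2
      ≤ ∑ j ∈ Finset.range n, (j : ℝ) * ∑ i ∈ Finset.range n, ‖v (i + 1) - v i‖ ^ 2 := by
        refine Finset.sum_le_sum fun j hj => (norm_sq_le_mul_sum_norm_sub_sq v hv0 j).trans ?_
        gcongr
        exact (Finset.mem_range.mp hj).le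
    _ ≤ (n : ℝ) ^ 2 / 2 * ∑ i ∈ Finset.range n, ‖v (i + 1) - v i‖ ^ 2 := by
        rw [← Finset.sum_mul]
        gcongr
        exact sum_range_natCast_le n

/-- Discrete Poincaré–Friedrichs inequality: for `v ∈ X_h`,
`‖v‖_{0,h} ≤ (√2/2) · |v|_{1,h}`, where `h = 1/J`. -/
theorem stmt_10 (J : ℕ) (hJ : 3 ≤ J) (v : ℕ → ℂ) (hv0 : v 0 = 0) (hvJ : v J = 0) :
    Real.sqrt ((J : ℝ)⁻¹ * ∑ j ∈ Finset.Ioo 0 J, ‖v j‖ ^ 2)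
      ≤ (Real.sqrt 2 / 2) *
        Real.sqrt ((J : ℝ)⁻¹ * ∑ j ∈ Finset.range J, ‖(v (j + 1) - v j) * (J : ℂ)‖ ^ 2) := by
  have hsub : ∑ j ∈ Finset.Ioo 0 J, ‖v j‖ ^ 2 ≤ ∑ j ∈ Finset.range J, ‖v j‖ ^ 2 :=
    Finset.sum_le_sum_of_subset_of_nonneg
      (fun j hj => Finset.mem_range.mpr (Finset.mem_Ioo.mp hj).2) fun _ _ _ => by positivity
  have hscale : ∑ j ∈ Finset.range J, ‖(v (j + 1) - v j) * (J : ℂ)‖ ^ 2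
      = (J : ℝ) ^ 2 * ∑ j ∈ Finset.range J, ‖v (j + 1) - v j‖ ^ 2 := by
    rw [Finset.mul_sum]
    refine Finset.sum_congr rfl fun j _ => ?_
    rw [norm_mul, Complex.norm_natCast]
    ring
  have hmain := hsub.trans (sum_norm_sq_le_sum_norm_sub_sq v hv0 J)
  refine Real.sqrt_le_iff.mpr ⟨by positivity, ?_⟩
  rw [mul_pow, div_pow, Real.sq_sqrt zero_le_two, Real.sq_sqrt (by positivity), hscale]
  calc (J : ℝ)⁻¹ * ∑ j ∈ Finset.Ioo 0 J, ‖v j‖ ^ 2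
      ≤ (J : ℝ)⁻¹ * ((J : ℝ) ^ 2 / 2 * ∑ i ∈ Finset.range J, ‖v (i + 1) - v i‖ ^ 2) := by
        gcongr
    _ = _ := by ring
end

section
/- For every v ∈ X_h there holds Re (ω ⊗ ∂_h v, v)_{0,h} = −(1/2)·Re (v, I_h v)_{0,h}. -/
open Finset Complex

theorem sum_Ioo_zero_succ_sub_pred {M : Type*} [AddCommGroup M] (f : ℕ → M) (n : ℕ) :
    ∑ j ∈ Finset.Ioo 0 (n + 1), (f j - f (j - 1)) = f n - f 0 := by
  have h : Finset.Ioo 0 (n + 1) = Finset.Ico (0 + 1) (n + 1) := by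
    ext j
    simp only [Finset.mem_Ioo, Finset.mem_Ico]
    omega
  rw [h, ← Finset.sum_Ico_add' (fun j => f j - f (j - 1)) 0 n 1, ← Finset.range_eq_Ico]
  exact Finset.sum_range_sub f n

/-- For every `v ∈ X_h`,
`Re (ω ⊗ ∂_h v, v)_{0,h} = -(1/2) · Re (v, I_h v)_{0,h}`, where `h = 1/J`,
`ω_j = j·h`, `(∂_h v)_j = (v_{j+1} - v_{j-1})/(2h)` and `(I_h v)_j = (v_{j+1} + v_{j-1})/2`. -/
theorem stmt_14 (J : ℕ) (hJ : 3 ≤ J) (v : ℕ → ℂ) (hv0 : v 0 = 0) (hvJ : v J = 0) :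
    (((J : ℝ)⁻¹ : ℂ) * ∑ j ∈ Finset.Ioo 0 J,
        (((j : ℂ) / (J : ℂ)) * ((v (j + 1) - v (j - 1)) * (J : ℂ) / 2)) * (starRingEnd ℂ) (v j)).re
      = -(1 / 2) * (((J : ℝ)⁻¹ : ℂ) * ∑ j ∈ Finset.Ioo 0 J,
          v j * (starRingEnd ℂ) ((v (j + 1) + v (j - 1)) / 2)).re := by
  obtain ⟨n, rfl⟩ : ∃ n, J = n + 1 := ⟨J - 1, by omega⟩
  have hn : ((n + 1 : ℕ) : ℂ) ≠ 0 := Nat.cast_ne_zero.mpr n.succ_ne_zero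
  have htel := sum_Ioo_zero_succ_sub_pred
    (fun j => ((j : ℝ) / 2 + 1 / 4) * (v (j + 1) * (starRingEnd ℂ) (v j)).re) n
  simp only [hv0, hvJ, map_zero, mul_zero, zero_mul, Complex.zero_re, sub_zero] at htel
  have hcast : ((((n + 1 : ℕ) : ℝ) : ℂ))⁻¹ = ((((n + 1 : ℕ) : ℝ)⁻¹ : ℝ) : ℂ) := by
    push_cast
    rfl
  rw [hcast, Complex.re_ofReal_mul, Complex.re_ofReal_mul, Complex.re_sum, Complex.re_sum,
    mul_left_comm]
  congr 1
  rw [← sub_eq_zero, Finset.mul_sum, ← Finset.sum_sub_distrib, ← htel]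
  refine Finset.sum_congr rfl fun j hj => ?_
  obtain ⟨k, rfl⟩ : ∃ k, j = k + 1 := ⟨j - 1, by have := (Finset.mem_Ioo.mp hj).1; omega⟩
  have hterm : ((k + 1 : ℕ) : ℂ) / ((n + 1 : ℕ) : ℂ) *
      ((v (k + 1 + 1) - v (k + 1 - 1)) * ((n + 1 : ℕ) : ℂ) / 2) * (starRingEnd ℂ) (v (k + 1)) =
      ((((k : ℝ) + 1) / 2 : ℝ) : ℂ) *
        ((v (k + 1 + 1) - v k) * (starRingEnd ℂ) (v (k + 1))) := by
    rw [Nat.add_sub_cancel]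
    field_simp
    push_cast
    ring
  have havg : v (k + 1) * (starRingEnd ℂ) ((v (k + 1 + 1) + v (k + 1 - 1)) / 2) =
      ((1 / 2 : ℝ) : ℂ) * (v (k + 1) * (starRingEnd ℂ) (v (k + 1 + 1) + v k)) := by
    rw [Nat.add_sub_cancel, map_div₀, Complex.conj_ofNat]
    push_cast
    ring
  rw [hterm, havg, Complex.re_ofReal_mul, Complex.re_ofReal_mul, Nat.add_sub_cancel]
  simp only [Complex.mul_re, Complex.sub_re, Complex.sub_im, Complex.add_re, Complex.add_im,
    Complex.conj_re, Complex.conj_im, Nat.cast_add, Nat.cast_one]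
  ring
end

section
/- Discrete Sobolev-type inequality: for every v ∈ X_h there holds |v|_{∞,h} ≤ √2·( ‖v‖_{0,h} + ‖∂_h v‖_{0,h} ). -/
open Finset Complex

lemma sum_odd_shift_le_sum_Ioo {J k m : ℕ} (hk : k + 2 * m ≤ J) (f : ℕ → ℝ)
    (hf : ∀ i, 0 ≤ f i) :
    ∑ l ∈ Finset.range m, f (k + 2 * l + 1) ≤ ∑ i ∈ Finset.Ioo 0 J, f i := by
  have hinj : Set.InjOn (fun l => k + 2 * l + 1) (Finset.range m : Set ℕ) := by
    intro a _ b _ h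
    simp only at h
    omega
  rw [← Finset.sum_image (f := f) hinj]
  refine Finset.sum_le_sum_of_subset_of_nonneg ?_ fun i _ _ => hf i
  intro i hi
  simp only [Finset.mem_image, Finset.mem_range, Finset.mem_Ioo] at hi ⊢
  omega

lemma norm_sub_le_sqrt_two_mul_of_even_step {J : ℕ} (hJ : 0 < J) (v : ℕ → ℂ) {k m : ℕ}
    (hk : k + 2 * m ≤ J) :
    ‖v (k + 2 * m) - v k‖ ≤ Real.sqrt 2 * Real.sqrt ((J : ℝ)⁻¹ * ∑ i ∈ Finset.Ioo 0 J,
      ‖(v (i + 1) - v (i - 1)) * (J : ℂ) / 2‖ ^ 2) := by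
  have hJ' : (0 : ℝ) < J := by exact_mod_cast hJ
  have hJc : (J : ℂ) ≠ 0 := by exact_mod_cast hJ.ne'
  set D : ℕ → ℂ := fun i => (v (i + 1) - v (i - 1)) * (J : ℂ) / 2 with hD
  set S : ℝ := ∑ i ∈ Finset.Ioo 0 J, ‖D i‖ ^ 2 with hS
  have hS0 : 0 ≤ S := Finset.sum_nonneg fun i _ => sq_nonneg _
  have htel : (v (k + 2 * m) - v k) * J = 2 * ∑ l ∈ Finset.range m, D (k + 2 * l + 1) := by
    have h := Finset.sum_range_sub (fun l => v (k + 2 * l)) m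
    simp only [mul_zero, add_zero] at h
    rw [← h, Finset.sum_mul, Finset.mul_sum]
    refine Finset.sum_congr rfl fun l _ => ?_
    simp only [hD, show k + 2 * (l + 1) = k + 2 * l + 1 + 1 by ring, Nat.add_sub_cancel]
    ring
  have hnorm : ‖v (k + 2 * m) - v k‖ * J ≤ 2 * ∑ l ∈ Finset.range m, ‖D (k + 2 * l + 1)‖ := by
    have h := congrArg norm htel
    rw [norm_mul, norm_mul, Complex.norm_natCast, Complex.norm_ofNat] at h
    rw [h]
    gcongr
    exact norm_sum_le _ _
  have hcs : (∑ l ∈ Finset.range m, ‖D (k + 2 * l + 1)‖) ^ 2 ≤ m * S := by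
    have h := sq_sum_le_card_mul_sum_sq (s := Finset.range m)
      (f := fun l => ‖D (k + 2 * l + 1)‖)
    rw [Finset.card_range] at h
    refine h.trans ?_
    gcongr
    exact sum_odd_shift_le_sum_Ioo hk (fun i => ‖D i‖ ^ 2) fun i => sq_nonneg _
  have hm : 2 * (m : ℝ) ≤ J := by exact_mod_cast (by omega : 2 * m ≤ J)
  rw [← Real.sqrt_mul zero_le_two]
  apply Real.le_sqrt_of_sq_le
  have hsq : (‖v (k + 2 * m) - v k‖ * J) ^ 2 ≤ 2 * J * S := by
    have h := pow_le_pow_left₀ (by positivity) hnorm 2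
    have h' := mul_le_mul_of_nonneg_right hm hS0
    nlinarith
  have hrw : 2 * ((J : ℝ)⁻¹ * S) = 2 * J * S / (J : ℝ) ^ 2 := by field_simp
  rw [hrw, le_div_iff₀ (by positivity), ← mul_pow]
  exact hsq

lemma exists_odd_norm_le_sqrt_two_mul {n : ℕ} (hn : 0 < n) (v : ℕ → ℂ) :
    ∃ l < n, ‖v (2 * l + 1)‖ ≤ Real.sqrt 2 *
      Real.sqrt (((2 * n : ℕ) : ℝ)⁻¹ * ∑ i ∈ Finset.Ioo 0 (2 * n), ‖v i‖ ^ 2) := by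
  have hn' : (0 : ℝ) < n := by exact_mod_cast hn
  set S : ℝ := ∑ i ∈ Finset.Ioo 0 (2 * n), ‖v i‖ ^ 2 with hS
  have hsum : ∑ l ∈ Finset.range n, ‖v (2 * l + 1)‖ ^ 2 ≤ ∑ l ∈ Finset.range n, S / n := by
    have h := sum_odd_shift_le_sum_Ioo (J := 2 * n) (k := 0) (m := n) (by omega)
      (fun i => ‖v i‖ ^ 2) fun i => sq_nonneg _
    simp only [zero_add] at h
    rw [Finset.sum_const, Finset.card_range, nsmul_eq_mul, mul_div_cancel₀ _ hn'.ne']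
    exact h
  obtain ⟨l, hl, hle⟩ := Finset.exists_le_of_sum_le
    (Finset.nonempty_range_iff.mpr hn.ne') hsum
  refine ⟨l, Finset.mem_range.mp hl, ?_⟩
  rw [← Real.sqrt_mul zero_le_two]
  apply Real.le_sqrt_of_sq_le
  refine hle.trans_eq ?_
  push_cast
  field_simp

open Finset Complex
/-- Discrete Sobolev-type inequality: for every `v ∈ X_h`,
`|v|_{∞,h} ≤ √2 · (‖v‖_{0,h} + ‖∂_h v‖_{0,h})`, where `h = 1/J` and
`(∂_h v)_j = (v_{j+1} - v_{j-1})/(2h)` for `j = 1, …, J-1`. -/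
theorem stmt_16 (J : ℕ) (hJ : 3 ≤ J) (v : ℕ → ℂ) (hv0 : v 0 = 0) (hvJ : v J = 0) :
    ∀ j ∈ Finset.Ioo 0 J, ‖v j‖
      ≤ Real.sqrt 2 *
        (Real.sqrt ((J : ℝ)⁻¹ * ∑ i ∈ Finset.Ioo 0 J, ‖v i‖ ^ 2)
          + Real.sqrt ((J : ℝ)⁻¹ * ∑ i ∈ Finset.Ioo 0 J,
              ‖(v (i + 1) - v (i - 1)) * (J : ℂ) / 2‖ ^ 2)) := by
  intro j hj
  rw [Finset.mem_Ioo] at hj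
  have hJ0 : 0 < J := by omega
  have hstep := fun {k m : ℕ} (hk : k + 2 * m ≤ J) =>
    norm_sub_le_sqrt_two_mul_of_even_step hJ0 v hk
  rw [mul_add]
  have hM : 0 ≤ Real.sqrt 2 * Real.sqrt ((J : ℝ)⁻¹ * ∑ i ∈ Finset.Ioo 0 J, ‖v i‖ ^ 2) := by
    positivity
  obtain ⟨a, rfl | rfl⟩ := Nat.even_or_odd' j
  · have h := hstep (k := 0) (m := a) (by omega)
    rw [zero_add, hv0, sub_zero] at h
    linarith
  · obtain ⟨n, rfl | rfl⟩ := Nat.even_or_odd' J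
    · obtain ⟨l, hl, hle⟩ := exists_odd_norm_le_sqrt_two_mul (n := n) (by omega) v
      have htri := norm_le_norm_add_norm_sub' (v (2 * a + 1)) (v (2 * l + 1))
      rcases le_total l a with hla | hla
      · have h := hstep (k := 2 * l + 1) (m := a - l) (by omega)
        rw [show 2 * l + 1 + 2 * (a - l) = 2 * a + 1 by omega] at h
        linarith
      · have h := hstep (k := 2 * a + 1) (m := l - a) (by omega)
        rw [show 2 * a + 1 + 2 * (l - a) = 2 * l + 1 by omega, norm_sub_rev] at h
        linarith
    · have h := hstep (k := 2 * a + 1) (m := n - a) (by omega)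
      rw [show 2 * a + 1 + 2 * (n - a) = 2 * n + 1 by omega, hvJ, zero_sub, norm_neg] at h
      linarith
end

section
/- Stability of the Crank–Nicolson finite difference scheme: there exist constants c* > 0 and C₁ > 0, depending only on D := max_n |δ_n|, Ξ := max_n |ξ_n|, |μ|, C_T and on N·k, such that the following holds. Suppose (e^n)_{n=0}^N ⊂ X_h and (η^n)_{n=1}^N ⊂ X_h satisfy e^0 = 0 and, for n = 1,…,N, (e^n − e^{n−1})/k − δ_n·ω ⊗ ∂_h((e^n + e^{n−1})/2) = i·ξ_n·T_n((e^n + e^{n−1})/2) + i·μ·(e^n + e^{n−1})/2 + η^n. If k·c* ≤ 1/3, then max_{0≤n≤N} ‖e^n‖_{0,h} ≤ C₁·max_{1≤n≤N} ‖η^n‖_{0,h}. -/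
open Finset Complex

/-- Membership in `X_h`: grid functions vanishing at `j = 0` and for `j ≥ J`
(identifying `X_h ⊆ ℂ^{J+1}` with sequences extended by zero). -/
def memXh (J : ℕ) (v : ℕ → ℂ) : Prop := v 0 = 0 ∧ ∀ j, J ≤ j → v j = 0

/-- The discrete `L²` norm `‖v‖_{0,h}`, `h = 1/J`. -/
noncomputable def dnorm0 (J : ℕ) (v : ℕ → ℂ) : ℝ :=
  Real.sqrt ((J : ℝ)⁻¹ * ∑ j ∈ Finset.Ioo 0 J, ‖v j‖ ^ 2)

/-- The interior values of a grid function, as a vector of a Euclidean space. -/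
noncomputable def gridVec (J : ℕ) (v : ℕ → ℂ) : EuclideanSpace ℂ (Finset.Ioo 0 J) :=
  WithLp.toLp 2 fun j => v j

theorem dnorm0_eq (J : ℕ) (v : ℕ → ℂ) :
    dnorm0 J v = Real.sqrt ((J : ℝ)⁻¹) * ‖gridVec J v‖ := by
  rw [dnorm0, Real.sqrt_mul (by positivity), EuclideanSpace.norm_eq]
  congr 2
  exact (Finset.sum_coe_sort (Finset.Ioo 0 J) fun j => ‖v j‖ ^ 2).symm

theorem sum_Ioo_zero_eq_sum_range {M : Type*} [AddCommMonoid M] (f : ℕ → M) (h0 : f 0 = 0)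
    (n : ℕ) : ∑ j ∈ Finset.Ioo 0 n, f j = ∑ j ∈ Finset.range n, f j := by
  refine Finset.sum_subset (fun j hj => ?_) (fun j hj hj' => ?_)
  · simp only [Finset.mem_Ioo, Finset.mem_range] at *
    exact hj.2
  · simp only [Finset.mem_Ioo, Finset.mem_range] at *
    obtain rfl : j = 0 := by omega
    exact h0

theorem sum_range_mul_sub_pred (a : ℕ → ℝ) (n : ℕ) :
    ∑ j ∈ Finset.range (n + 1), (j : ℝ) * (a j - a (j - 1)) =
      n * a n - ∑ j ∈ Finset.range n, a j := by
  induction n with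
  | zero => simp
  | succ n ih =>
    rw [Finset.sum_range_succ, ih, Finset.sum_range_succ, Nat.add_sub_cancel]
    push_cast
    ring

/-- The operator `ω ⊗ ∂_h`. -/
noncomputable def weightedDiff (J : ℕ) (v : ℕ → ℂ) (j : ℕ) : ℂ :=
  ((j : ℂ) / (J : ℂ)) * ((v (j + 1) - v (j - 1)) * (J : ℂ) / 2)

theorem norm_gridVec_sq {J : ℕ} {v : ℕ → ℂ} (h0 : v 0 = 0) :
    ‖gridVec J v‖ ^ 2 = ∑ j ∈ Finset.range J, ‖v j‖ ^ 2 := by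
  rw [EuclideanSpace.norm_sq_eq, ← sum_Ioo_zero_eq_sum_range _ (by simp [h0])]
  exact Finset.sum_coe_sort (Finset.Ioo 0 J) fun j => ‖v j‖ ^ 2

theorem abs_re_mul_conj_le (z w : ℂ) :
    |(z * (starRingEnd ℂ) w).re| ≤ (‖z‖ ^ 2 + ‖w‖ ^ 2) / 2 := by
  have h := Complex.abs_re_le_norm (z * (starRingEnd ℂ) w)
  rw [norm_mul, RCLike.norm_conj] at h
  nlinarith [sq_nonneg (‖z‖ - ‖w‖)]

/-- Summation by parts: `ω ⊗ ∂_h` is bounded as a quadratic form, uniformly in the mesh size. -/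
theorem abs_re_inner_weightedDiff_le {J : ℕ} (hJ : 0 < J) {v : ℕ → ℂ} (hv : memXh J v) :
    |(inner ℂ (gridVec J v) (gridVec J (weightedDiff J v))).re| ≤ ‖gridVec J v‖ ^ 2 / 2 := by
  obtain ⟨n, rfl⟩ : ∃ n, J = n + 1 := ⟨J - 1, by omega⟩
  set a : ℕ → ℝ := fun j => (v (j + 1) * (starRingEnd ℂ) (v j)).re with ha
  have hn : a n = 0 := by simp [ha, hv.2 (n + 1) le_rfl]
  have hterm : ∀ j ∈ Finset.range (n + 1),
      (weightedDiff (n + 1) v j * (starRingEnd ℂ) (v j)).re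
        = (j : ℝ) * (a j - a (j - 1)) / 2 := by
    intro j _
    rcases j with _ | j
    · simp [weightedDiff]
    · have hne : (((n + 1 : ℕ) : ℂ)) ≠ 0 := by exact_mod_cast Nat.succ_ne_zero n
      have : weightedDiff (n + 1) v (j + 1) =
          (((j + 1 : ℕ) : ℝ) / 2 : ℝ) * (v (j + 2) - v j) := by
        simp only [weightedDiff, Nat.add_sub_cancel]
        field_simp
        push_cast
        ring
      rw [this, mul_assoc, Complex.re_ofReal_mul]
      simp only [ha, Nat.add_sub_cancel, Complex.mul_re, Complex.sub_re, Complex.sub_im,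
        Complex.conj_re, Complex.conj_im]
      ring
  have hinner : (inner ℂ (gridVec (n + 1) v) (gridVec (n + 1) (weightedDiff (n + 1) v))).re
      = -(∑ j ∈ Finset.range n, a j) / 2 := by
    calc (inner ℂ (gridVec (n + 1) v) (gridVec (n + 1) (weightedDiff (n + 1) v))).re
        = ∑ j ∈ Finset.Ioo 0 (n + 1),
            (weightedDiff (n + 1) v j * (starRingEnd ℂ) (v j)).re := by
          rw [PiLp.inner_apply, Complex.re_sum]
          exact Finset.sum_coe_sort (Finset.Ioo 0 (n + 1)) fun j =>
            (weightedDiff (n + 1) v j * (starRingEnd ℂ) (v j)).re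
      _ = ∑ j ∈ Finset.range (n + 1), (j : ℝ) * (a j - a (j - 1)) / 2 := by
          rw [sum_Ioo_zero_eq_sum_range _ (by simp [hv.1]), Finset.sum_congr rfl hterm]
      _ = -(∑ j ∈ Finset.range n, a j) / 2 := by
          rw [← Finset.sum_div, sum_range_mul_sub_pred, hn]
          ring
  have hsum : |∑ j ∈ Finset.range n, a j| ≤ ‖gridVec (n + 1) v‖ ^ 2 := by
    have h1 : |∑ j ∈ Finset.range n, a j| ≤
        ∑ j ∈ Finset.range n, (‖v (j + 1)‖ ^ 2 + ‖v j‖ ^ 2) / 2 :=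
      (Finset.abs_sum_le_sum_abs _ _).trans
        (Finset.sum_le_sum fun j _ => abs_re_mul_conj_le _ _)
    have h2 := Finset.sum_range_succ (fun j => ‖v j‖ ^ 2) n
    have h3 := Finset.sum_range_succ' (fun j => ‖v j‖ ^ 2) n
    rw [norm_gridVec_sq hv.1]
    rw [← Finset.sum_div, Finset.sum_add_distrib] at h1
    nlinarith [sq_nonneg ‖v n‖, sq_nonneg ‖v 0‖]
  rw [hinner, abs_div, abs_neg, abs_two]
  linarith

/-- The energy estimate for one Crank–Nicolson step in an inner product space. -/
theorem norm_sub_norm_le_of_re_inner_le {E : Type*} [NormedAddCommGroup E]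
    [InnerProductSpace ℂ E] {a b m g : E} {k A B : ℝ} (hk : 0 ≤ k) (hA : 0 ≤ A) (hB : 0 ≤ B)
    (hm : a + b = (2 : ℂ) • m) (hg : a - b = (k : ℂ) • g)
    (hmg : (inner ℂ m g).re ≤ A * ‖m‖ ^ 2 + B * ‖m‖) :
    ‖a‖ - ‖b‖ ≤ k * (A * ((‖a‖ + ‖b‖) / 2) + B) := by
  have hsq : ‖a‖ ^ 2 - ‖b‖ ^ 2 = 2 * k * (inner ℂ m g).re := by
    have h1 : (inner ℂ (a + b) (a - b)).re = ‖a‖ ^ 2 - ‖b‖ ^ 2 := by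
      rw [inner_add_left, inner_sub_right, inner_sub_right]
      have := inner_re_symm (𝕜 := ℂ) a b
      have ha := inner_self_eq_norm_sq (𝕜 := ℂ) a
      have hb := inner_self_eq_norm_sq (𝕜 := ℂ) b
      simp only [RCLike.re_to_complex] at this ha hb
      simp only [Complex.add_re, Complex.sub_re]
      linarith
    rw [← h1, hm, hg, inner_smul_left, inner_smul_right]
    simp
    ring
  have hM : ‖m‖ ≤ (‖a‖ + ‖b‖) / 2 := by
    have := norm_add_le a b
    rw [hm, norm_smul] at this
    norm_num at this
    linarith
  have hm0 := norm_nonneg m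
  rcases (add_nonneg (norm_nonneg a) (norm_nonneg b)).eq_or_lt with hs | hs
  · have : 0 ≤ k * (A * ((‖a‖ + ‖b‖) / 2) + B) := by positivity
    linarith [norm_nonneg a, norm_nonneg b]
  · refine le_of_mul_le_mul_right ?_ hs
    calc (‖a‖ - ‖b‖) * (‖a‖ + ‖b‖) = 2 * k * (inner ℂ m g).re := by rw [← hsq]; ring
      _ ≤ 2 * k * (A * ‖m‖ ^ 2 + B * ‖m‖) := by gcongr
      _ ≤ 2 * k * (A * ((‖a‖ + ‖b‖) / 2) ^ 2 + B * ((‖a‖ + ‖b‖) / 2)) := by gcongr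
      _ = k * (A * ((‖a‖ + ‖b‖) / 2) + B) * (‖a‖ + ‖b‖) := by ring

/-- A discrete Grönwall inequality for Crank–Nicolson type recursions. -/
theorem le_exp_mul_of_sub_le {N : ℕ} {E : ℕ → ℝ} {k A B : ℝ} (hk : 0 ≤ k) (hA : 1 ≤ A)
    (hkA : k * A ≤ 1 / 3) (hB : 0 ≤ B) (hE : ∀ n, 0 ≤ E n) (h0 : E 0 = 0)
    (hstep : ∀ n, n + 1 ≤ N → E (n + 1) - E n ≤ k * (A * ((E (n + 1) + E n) / 2) + B)) :
    ∀ n, n ≤ N → E n ≤ Real.exp (2 * A * (n * k)) * B := by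
  suffices ∀ n, n ≤ N → E n + B ≤ Real.exp (2 * A * (n * k)) * B from
    fun n hn => by linarith [this n hn]
  intro n
  induction n with
  | zero => simp [h0]
  | succ n ih =>
    intro hn
    have hx : 0 ≤ k * A := by positivity
    have hs := hstep n hn
    have hkB : k * B ≤ k * A * B := by nlinarith [mul_nonneg hk hB]
    have h1 : E (n + 1) + B ≤ (1 + 2 * (k * A)) * (E n + B) := by
      nlinarith [hE n, hE (n + 1), mul_nonneg hx (hE n), mul_nonneg hx hB]
    calc E (n + 1) + B ≤ (1 + 2 * (k * A)) * (E n + B) := h1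
      _ ≤ Real.exp (2 * (k * A)) * (Real.exp (2 * A * (n * k)) * B) := by
          have := Real.add_one_le_exp (2 * (k * A))
          gcongr
          · linarith [hE n]
          · linarith
          · exact ih (by omega)
      _ = Real.exp (2 * A * ((n + 1 : ℕ) * k)) * B := by
          rw [← mul_assoc, ← Real.exp_add]
          push_cast
          ring_nf

theorem re_inner_smul_le {E : Type*} [NormedAddCommGroup E] [InnerProductSpace ℂ E]
    (c : ℂ) (x y : E) : (inner ℂ x (c • y)).re ≤ ‖c‖ * (‖x‖ * ‖y‖) := by
  rw [inner_smul_right]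
  refine (Complex.re_le_norm _).trans ?_
  rw [norm_mul]
  gcongr
  exact norm_inner_le_norm x y

/-- The right-hand side of the scheme is bounded as a quadratic form. -/
theorem re_inner_gridVec_rhs_le {J : ℕ} (hJ : 0 < J) {D X M C H δ : ℝ} {ξ μ : ℂ}
    {m t s : ℕ → ℂ} (hm : memXh J m) (hδ : |δ| ≤ D) (hξ : ‖ξ‖ ≤ X) (hμ : ‖μ‖ ≤ M)
    (ht : ‖gridVec J t‖ ≤ C * ‖gridVec J m‖) (hs : ‖gridVec J s‖ ≤ H) :
    (inner ℂ (gridVec J m) ((δ : ℂ) • gridVec J (weightedDiff J m) +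
        (Complex.I * ξ) • gridVec J t + (Complex.I * μ) • gridVec J m + gridVec J s)).re ≤
      (D / 2 + X * C + M) * ‖gridVec J m‖ ^ 2 + H * ‖gridVec J m‖ := by
  have hm0 := norm_nonneg (gridVec J m)
  have hX : 0 ≤ X := (norm_nonneg ξ).trans hξ
  have h1 : (inner ℂ (gridVec J m) ((δ : ℂ) • gridVec J (weightedDiff J m))).re ≤
      D * (‖gridVec J m‖ ^ 2 / 2) := by
    rw [inner_smul_right, Complex.re_ofReal_mul]
    refine (le_abs_self _).trans ?_
    rw [abs_mul]
    exact mul_le_mul hδ (abs_re_inner_weightedDiff_le hJ hm) (abs_nonneg _)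
      ((abs_nonneg δ).trans hδ)
  have h2 : (inner ℂ (gridVec J m) ((Complex.I * ξ) • gridVec J t)).re ≤
      X * (‖gridVec J m‖ * (C * ‖gridVec J m‖)) := by
    refine (re_inner_smul_le _ _ _).trans ?_
    rw [norm_mul, Complex.norm_I, one_mul]
    gcongr
  have h3 : (inner ℂ (gridVec J m) ((Complex.I * μ) • gridVec J m)).re ≤
      M * (‖gridVec J m‖ * ‖gridVec J m‖) := by
    refine (re_inner_smul_le _ _ _).trans ?_
    rw [norm_mul, Complex.norm_I, one_mul]
    gcongr
  have h4 : (inner ℂ (gridVec J m) (gridVec J s)).re ≤ ‖gridVec J m‖ * H := by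
    refine (Complex.re_le_norm _).trans ((norm_inner_le_norm _ _).trans ?_)
    gcongr
  simp only [inner_add_right, Complex.add_re]
  linarith

/-- Stability of the Crank–Nicolson finite difference scheme: there are
constants `c* > 0`, `C₁ > 0` depending only on `D = max |δ_n|`, `Ξ = max |ξ_n|`,
`|μ|`, `C_T` and `N·k`, such that if `e⁰ = 0`,
`(eⁿ - eⁿ⁻¹)/k - δ_n ω ⊗ ∂_h((eⁿ+eⁿ⁻¹)/2) = i ξ_n T_n((eⁿ+eⁿ⁻¹)/2) + i μ (eⁿ+eⁿ⁻¹)/2 + ηⁿ`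
for `n = 1, …, N`, and `k·c* ≤ 1/3`, then
`max_{0≤n≤N} ‖eⁿ‖_{0,h} ≤ C₁ · max_{1≤n≤N} ‖ηⁿ‖_{0,h}`. -/
theorem stmt_19 (Dmax Ximax Mmu CT L : ℝ) (hCT : 0 < CT) :
    ∃ cstar > (0 : ℝ), ∃ C₁ > (0 : ℝ),
      ∀ (J : ℕ), 3 ≤ J →
      ∀ (N : ℕ) (k : ℝ), 0 < k → (N : ℝ) * k ≤ L →
      ∀ μ : ℂ, ‖μ‖ ≤ Mmu →
      ∀ δ : ℕ → ℝ, (∀ n, 1 ≤ n → n ≤ N → |δ n| ≤ Dmax) →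
      ∀ ξ : ℕ → ℂ, (∀ n, 1 ≤ n → n ≤ N → ‖ξ n‖ ≤ Ximax) →
      ∀ T : ℕ → (ℕ → ℂ) →ₗ[ℂ] (ℕ → ℂ),
        (∀ n, 1 ≤ n → n ≤ N → ∀ v : ℕ → ℂ, memXh J v → memXh J (T n v)) →
        (∀ n, 1 ≤ n → n ≤ N → ∀ v : ℕ → ℂ, memXh J v →
          dnorm0 J (T n v) ≤ CT * dnorm0 J v) →
      ∀ e η : ℕ → ℕ → ℂ,
        (∀ n, n ≤ N → memXh J (e n)) →
        (∀ n, 1 ≤ n → n ≤ N → memXh J (η n)) →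
        (∀ j, e 0 j = 0) →
        (∀ n, 1 ≤ n → n ≤ N → ∀ j, 0 < j → j < J →
          (e n j - e (n - 1) j) / (k : ℂ)
            - (δ n : ℂ) * ((j : ℂ) / (J : ℂ)) *
                ((((e n (j + 1) + e (n - 1) (j + 1)) / 2)
                  - ((e n (j - 1) + e (n - 1) (j - 1)) / 2)) * (J : ℂ) / 2)
          = Complex.I * ξ n * (T n (fun i => (e n i + e (n - 1) i) / 2)) j
            + Complex.I * μ * ((e n j + e (n - 1) j) / 2) + η n j) →
        k * cstar ≤ 1 / 3 →
        ∀ B : ℝ, 0 ≤ B → (∀ n, 1 ≤ n → n ≤ N → dnorm0 J (η n) ≤ B) →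
        ∀ n, n ≤ N → dnorm0 J (e n) ≤ C₁ * B := by
  set A : ℝ := |Dmax / 2 + Ximax * CT + Mmu| + 1 with hAdef
  have hA : 1 ≤ A := by linarith [abs_nonneg (Dmax / 2 + Ximax * CT + Mmu)]
  refine ⟨A, by positivity, Real.exp (2 * A * L), Real.exp_pos _, ?_⟩
  intro J hJ N k hk hNk μ hμ δ hδ ξ hξ T hT hTb e η he hη he0 hscheme hkA B hB hηB n hn
  have hJ0 : 0 < J := by omega
  set c : ℝ := Real.sqrt ((J : ℝ)⁻¹) with hc
  have hcpos : 0 < c := Real.sqrt_pos.2 (by positivity)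
  have hstep : ∀ n, n + 1 ≤ N → dnorm0 J (e (n + 1)) - dnorm0 J (e n) ≤
      k * (A * ((dnorm0 J (e (n + 1)) + dnorm0 J (e n)) / 2) + B) := by
    intro n hn
    have h1 : 1 ≤ n + 1 := by omega
    set m : ℕ → ℂ := fun i => (e (n + 1) i + e n i) / 2 with hmdef
    have hm : memXh J m := by
      refine ⟨?_, fun j hj => ?_⟩
      · simp [hmdef, (he (n + 1) hn).1, (he n (by omega)).1]
      · simp [hmdef, (he (n + 1) hn).2 j hj, (he n (by omega)).2 j hj]
    have ht : ‖gridVec J (T (n + 1) m)‖ ≤ CT * ‖gridVec J m‖ := by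
      have := hTb (n + 1) h1 hn m hm
      rw [dnorm0_eq, dnorm0_eq, mul_left_comm] at this
      exact le_of_mul_le_mul_left this hcpos
    have hs : ‖gridVec J (η (n + 1))‖ ≤ B / c := by
      have := hηB (n + 1) h1 hn
      rw [dnorm0_eq] at this
      rwa [le_div_iff₀' hcpos]
    have hform := re_inner_gridVec_rhs_le hJ0 hm (hδ _ h1 hn) (hξ _ h1 hn) hμ ht hs
    have hsum : gridVec J (e (n + 1)) + gridVec J (e n) = (2 : ℂ) • gridVec J m := by
      ext j
      simp only [gridVec, hmdef, PiLp.add_apply, PiLp.smul_apply, smul_eq_mul]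
      ring
    have hdiff : gridVec J (e (n + 1)) - gridVec J (e n) = (k : ℂ) •
        ((δ (n + 1) : ℂ) • gridVec J (weightedDiff J m) +
          (Complex.I * ξ (n + 1)) • gridVec J (T (n + 1) m) +
          (Complex.I * μ) • gridVec J m + gridVec J (η (n + 1))) := by
      ext ⟨j, hj⟩
      have hj' := Finset.mem_Ioo.1 hj
      have hkne : (k : ℂ) ≠ 0 := by exact_mod_cast hk.ne'
      have heq := hscheme (n + 1) h1 hn j hj'.1 hj'.2
      rw [Nat.add_sub_cancel, sub_eq_iff_eq_add, div_eq_iff hkne] at heq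
      simp only [gridVec, PiLp.add_apply, PiLp.sub_apply, PiLp.smul_apply, smul_eq_mul,
        weightedDiff]
      rw [heq]
      simp only [hmdef]
      ring
    have hA' : Dmax / 2 + Ximax * CT + Mmu ≤ A := by
      linarith [le_abs_self (Dmax / 2 + Ximax * CT + Mmu)]
    have key := norm_sub_norm_le_of_re_inner_le (A := A) hk.le (by linarith)
      (by positivity : 0 ≤ B / c) hsum hdiff (hform.trans (by gcongr))
    have := mul_le_mul_of_nonneg_left key hcpos.le
    rw [dnorm0_eq, dnorm0_eq, ← hc]
    calc _ = c * (‖gridVec J (e (n + 1))‖ - ‖gridVec J (e n)‖) := by ring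
      _ ≤ _ := this
      _ = _ := by field_simp
  have hzero : dnorm0 J (e 0) = 0 := by simp [dnorm0, he0]
  refine (le_exp_mul_of_sub_le (E := fun n => dnorm0 J (e n)) hk.le hA hkA hB
    (fun n => Real.sqrt_nonneg _) hzero hstep n hn).trans ?_
  have hnN : (n : ℝ) * k ≤ L := le_trans (by gcongr) hNk
  gcongr
end
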